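/- arXiv:math/0508265 — 4 statements merged into one kernel-verified Lean document; each statement's English description precedes it below -/
import Mathlib

section
/- Let W be a generalized k-whirl (k ≥ 2) on n vertices with 2k legs α^i_j (i = 1,…,k, j = 1,2), each leg having at least one vertex, let A be a real symmetric matrix with graph W, and let A′ be the direct sum of the principal submatrices A[α^i_j] over all 2k legs. Then: (i) if λ is an eigenvalue of A with m_A(λ) = k + 1, then λ is a simple eigenvalue of A[α^i_j] for every leg, so m_{A′}(λ) = 2k; and (ii) if μ is an eigenvalue of A with m_A(μ) = k, then for all i ≠ s and all j, t, μ is a simple eigenvalue of at least one of A[α^i_j], A[α^s_t], and m_{A′}(μ) ≥ 2k − 2. -/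
open Polynomial Matrix

/-- The generalized `k`-whirl with leg lengths `L`: a tree consisting of an axis vertex
(`Sum.inl ()`), `k` vertices `v_1, …, v_k` adjacent to the axis (`Sum.inr (Sum.inl i)`),
and, for each `i` and each `j : Fin 2`, a pendant path (leg) with `L (i, j)` vertices
attached at `v_i`. -/
def genWhirl (k : ℕ) (L : Fin k × Fin 2 → ℕ) :
    SimpleGraph (Unit ⊕ Fin k ⊕ ((p : Fin k × Fin 2) × Fin (L p))) :=
  SimpleGraph.fromRel (fun a b =>
    match a, b with
    | Sum.inl _, Sum.inr (Sum.inl _) => True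
    | Sum.inr (Sum.inl i), Sum.inr (Sum.inr q) => q.1.1 = i ∧ (q.2 : ℕ) = 0
    | Sum.inr (Sum.inr q), Sum.inr (Sum.inr q') => q.1 = q'.1 ∧ (q.2 : ℕ) + 1 = (q'.2 : ℕ)
    | _, _ => False)


/-- The graph of a square matrix `M`: vertices are the indices, with an edge `u v`
(for `u ≠ v`) exactly when the corresponding entry is nonzero. -/
def graphOf {V R : Type*} [Zero R] (M : Matrix V V R) : SimpleGraph V :=
  SimpleGraph.fromRel (fun u v => M u v ≠ 0)

namespace WhirlAux

theorem mult_le {n ι : Type*} [Fintype n] [DecidableEq n] [Fintype ι]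
    (M : Matrix n n ℝ) (hM : M.IsSymm) (lam : ℝ) (f : ι → ((n → ℝ) →ₗ[ℝ] ℝ))
    (h : ∀ x : n → ℝ, M *ᵥ x = lam • x → (∀ i, f i x = 0) → x = 0) :
    M.charpoly.rootMultiplicity lam ≤ Fintype.card ι := by
  have hH : M.IsHermitian := by
    rw [Matrix.IsHermitian, Matrix.conjTranspose_eq_transpose_of_trivial]; exact hM
  have hS := Matrix.isSymmetric_toEuclideanLin_iff.2 hH
  have h1 := (Matrix.toEuclideanLin M).finrank_maxGenEigenspace_eq lam
  rw [hS.isFinitelySemisimple.maxGenEigenspace_eq_eigenspace] at h1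
  have h2 : (Matrix.toEuclideanLin M).charpoly = M.charpoly := by
    rw [Matrix.toEuclideanLin_eq_toLin_orthonormal, Matrix.charpoly_toLin]
  rw [h2] at h1
  rw [← h1]
  let g : Module.End.eigenspace (Matrix.toEuclideanLin M) lam →ₗ[ℝ] (ι → ℝ) :=
    LinearMap.pi (fun i => (f i).comp
      ((WithLp.linearEquiv 2 ℝ (n → ℝ)).toLinearMap.comp (Submodule.subtype _)))
  have hg : Function.Injective g := by
    rw [← LinearMap.ker_eq_bot, LinearMap.ker_eq_bot']
    rintro ⟨x, hx⟩ hx0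
    have hx' := Module.End.mem_eigenspace_iff.1 hx
    have := h (WithLp.ofLp x) (by
      have := congrArg WithLp.ofLp hx'
      simpa using this) (fun i => congrFun hx0 i)
    ext i
    exact congrFun this i
  have := LinearMap.finrank_le_finrank_of_injective hg
  simpa using this

theorem mult_pos {n : Type*} [Fintype n] [DecidableEq n]
    (M : Matrix n n ℝ) (lam : ℝ) (x : n → ℝ) (hx : x ≠ 0) (h : M *ᵥ x = lam • x) :
    1 ≤ M.charpoly.rootMultiplicity lam := by
  have h0 := M.charpoly_monic.ne_zero
  rw [Nat.succ_le_iff, Polynomial.rootMultiplicity_pos h0]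
  have : Module.End.HasEigenvalue (Matrix.toLin' M) lam :=
    Module.End.hasEigenvalue_of_hasEigenvector (x := x)
      ⟨Module.End.mem_eigenspace_iff.2 (by simpa using h), hx⟩
  have h3 := (Module.End.hasEigenvalue_iff_isRoot_charpoly _ _).1 this
  rwa [Matrix.charpoly_toLin'] at h3

theorem path_zero {n : ℕ} (hn : 0 < n) (C : Matrix (Fin n) (Fin n) ℝ)
    (h1 : ∀ i j : Fin n, (i : ℕ) + 1 < j → C i j = 0)
    (h2 : ∀ i j : Fin n, (i : ℕ) + 1 = j → C i j ≠ 0) (lam : ℝ) (u : Fin n → ℝ)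
    (hu : C *ᵥ u = lam • u) (h0 : u ⟨0, hn⟩ = 0) : u = 0 := by
  have key : ∀ m : ℕ, ∀ hm : m < n, u ⟨m, hm⟩ = 0 := by
    intro m
    induction m using Nat.strong_induction_on with
    | _ m ih =>
      intro hm
      rcases m with _ | m
      · exact h0
      · have hr := congrFun hu ⟨m, by omega⟩
        simp only [Matrix.mulVec, dotProduct, Pi.smul_apply, smul_eq_mul] at hr
        rw [ih m (by omega) (by omega), mul_zero,
          Finset.sum_eq_single (⟨m+1, hm⟩ : Fin n)] at hr
        · exact (mul_eq_zero.1 hr).resolve_left (h2 _ _ rfl)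
        · intro b _ hb
          rcases lt_trichotomy (b : ℕ) (m+1) with hlt | heq | hgt
          · rw [ih b hlt b.2, mul_zero]
          · exact absurd (Fin.ext heq) hb
          · rw [h1 _ _ hgt, zero_mul]
        · simp
  funext i
  exact key i i.2

abbrev WV (k : ℕ) (L : Fin k × Fin 2 → ℕ) := Unit ⊕ Fin k ⊕ ((p : Fin k × Fin 2) × Fin (L p))

section
variable {k : ℕ} {L : Fin k × Fin 2 → ℕ}

abbrev ax : WV k L := Sum.inl ()
abbrev vv (i : Fin k) : WV k L := Sum.inr (Sum.inl i)
abbrev lg (p : Fin k × Fin 2) (r : Fin (L p)) : WV k L := Sum.inr (Sum.inr ⟨p, r⟩)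

structure WF (hL : ∀ p, 1 ≤ L p) (A : Matrix (WV k L) (WV k L) ℝ) : Prop where
  symm : ∀ u v, A u v = A v u
  axl : ∀ p r, A ax (lg p r) = 0
  axv : ∀ i, A ax (vv i) ≠ 0
  vv0 : ∀ i j, i ≠ j → A (vv i) (vv j) = 0
  vl0 : ∀ i p (r : Fin (L p)), (p.1 ≠ i ∨ (r : ℕ) ≠ 0) → A (vv i) (lg p r) = 0
  vl : ∀ p, A (vv p.1) (lg p ⟨0, hL p⟩) ≠ 0
  ll0 : ∀ p q r s, p ≠ q → A (lg p r) (lg q s) = 0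
  lt : ∀ p (r s : Fin (L p)), (r : ℕ) + 1 < (s : ℕ) → A (lg p r) (lg p s) = 0
  ln : ∀ p (r s : Fin (L p)), (r : ℕ) + 1 = s → A (lg p r) (lg p s) ≠ 0

theorem mkWF (hL : ∀ p, 1 ≤ L p) (A : Matrix (WV k L) (WV k L) ℝ)
    (hA : A.IsSymm) (hG : graphOf A = genWhirl k L) : WF hL A := by
  have hs : ∀ u v, A u v = A v u := fun u v => hA.apply v u
  have key : ∀ u v, u ≠ v → (A u v ≠ 0 ↔ (genWhirl k L).Adj u v) := by
    intro u v huv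
    rw [← hG, graphOf, SimpleGraph.fromRel_adj, hs v u]
    simp [huv]
  constructor
  · exact hs
  · intro p r
    by_contra h
    rw [← ne_eq, key _ _ (by simp)] at h
    simp [genWhirl] at h
  · intro i
    rw [key _ _ (by simp)]
    simp [genWhirl]
  · intro i j hij
    by_contra h
    rw [← ne_eq, key _ _ (by simpa using hij)] at h
    simp [genWhirl] at h
  · intro i p r hh
    by_contra h
    rw [← ne_eq, key _ _ (by simp)] at h
    simp [genWhirl] at h
    rcases hh with hh | hh
    · exact hh h.1
    · exact hh h.2
  · intro p
    rw [key _ _ (by simp)]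
    simp [genWhirl]
  · intro p q r s hpq
    by_contra h
    rw [← ne_eq, key _ _ (by simp [hpq])] at h
    simp [genWhirl, hpq, Ne.symm hpq] at h
  · intro p r s hrs
    by_contra h
    rw [← ne_eq, key _ _ (by simp; intro h; subst h; omega)] at h
    simp [genWhirl] at h
    omega
  · intro p r s hrs
    rw [key _ _ (by simp; intro h; subst h; omega)]
    simp [genWhirl, hrs]
    intro h; subst h; omega

variable {hL : ∀ p, 1 ≤ L p} {A : Matrix (WV k L) (WV k L) ℝ}

theorem row_ax (F : WF hL A) (x : WV k L → ℝ) :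
    (A *ᵥ x) ax = A ax ax * x ax + ∑ i, A ax (vv i) * x (vv i) := by
  simp only [Matrix.mulVec, dotProduct, Fintype.sum_sum_type, Fintype.sum_sigma]
  simp [F.axl]

theorem row_lg (F : WF hL A) (x : WV k L → ℝ) (p) (r : Fin (L p)) :
    (A *ᵥ x) (lg p r) = A (lg p r) (vv p.1) * x (vv p.1)
      + ∑ s, A (lg p r) (lg p s) * x (lg p s) := by
  simp only [Matrix.mulVec, dotProduct, Fintype.sum_sum_type, Fintype.sum_sigma]
  rw [Finset.sum_eq_single p.1 (fun i _ hi => by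
      rw [F.symm, F.vl0 i p r (Or.inl hi.symm), zero_mul]) (by simp),
    Finset.sum_eq_single p (fun q _ hq => Finset.sum_eq_zero fun s _ => by
      rw [F.ll0 p q r s hq.symm, zero_mul]) (by simp)]
  simp [F.symm _ ax, F.axl]

theorem row_vv (F : WF hL A) (x : WV k L → ℝ) (i : Fin k) :
    (A *ᵥ x) (vv i) = A (vv i) ax * x ax + A (vv i) (vv i) * x (vv i)
      + ∑ j, A (vv i) (lg (i, j) ⟨0, hL _⟩) * x (lg (i, j) ⟨0, hL _⟩) := by
  simp only [Matrix.mulVec, dotProduct, Fintype.sum_sum_type, Fintype.sum_sigma,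
    Fintype.sum_prod_type]
  rw [Finset.sum_eq_single i (fun j _ hj => by
      rw [F.vv0 i j hj.symm, zero_mul]) (by simp),
    Finset.sum_eq_single i (fun q _ hq => Finset.sum_eq_zero fun j _ =>
      Finset.sum_eq_zero fun s _ => by
      rw [F.vl0 i (q, j) s (Or.inl hq), zero_mul]) (by simp)]
  have : ∀ j, ∑ s, A (vv i) (lg (i, j) s) * x (lg (i, j) s) =
      A (vv i) (lg (i, j) ⟨0, hL _⟩) * x (lg (i, j) ⟨0, hL _⟩) := by
    intro j
    rw [Finset.sum_eq_single (⟨0, hL _⟩ : Fin (L (i, j)))]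
    · intro s _ hs
      rw [F.vl0 i (i, j) s (Or.inr fun h => hs (Fin.ext h)), zero_mul]
    · simp
  rw [Finset.sum_congr rfl fun j _ => this j]
  simp [add_assoc]

abbrev leg (A : Matrix (WV k L) (WV k L) ℝ) (p) : Matrix (Fin (L p)) (Fin (L p)) ℝ :=
  A.submatrix (fun r => lg p r) (fun r => lg p r)

/-- the eigen-equation holds on all vertices except possibly the axis -/
def Ker (A : Matrix (WV k L) (WV k L) ℝ) (lam : ℝ) (x : WV k L → ℝ) : Prop :=
  ∀ w : Fin k ⊕ ((p : Fin k × Fin 2) × Fin (L p)), (A *ᵥ x) (Sum.inr w) = lam * x (Sum.inr w)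

def Sing (A : Matrix (WV k L) (WV k L) ℝ) (lam : ℝ) (p : Fin k × Fin 2) : Prop :=
  ∃ u : Fin (L p) → ℝ, u ≠ 0 ∧ leg A p *ᵥ u = lam • u

theorem leg_path (F : WF hL A) {lam : ℝ} (p) (u : Fin (L p) → ℝ)
    (hu : leg A p *ᵥ u = lam • u) (h0 : u ⟨0, hL p⟩ = 0) : u = 0 :=
  path_zero (hL p) (leg A p) (fun i j h => F.lt p i j h) (fun i j h => F.ln p i j h) lam u hu h0

theorem leg_mult (F : WF hL A) {lam : ℝ} {p} (h : Sing A lam p) :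
    (leg A p).charpoly.rootMultiplicity lam = 1 := by
  apply le_antisymm
  · have := mult_le (ι := Unit) (leg A p) (by ext i j; exact F.symm _ _) lam
      (fun _ => LinearMap.proj (⟨0, hL p⟩ : Fin (L p))) (fun x hx h => leg_path F p x hx (h ()))
    simpa using this
  · obtain ⟨u, hu, h⟩ := h
    exact mult_pos _ _ u hu h

theorem leg_eig (F : WF hL A) {lam : ℝ} {x} (hx : Ker A lam x) (p) (h0 : x (vv p.1) = 0) :
    leg A p *ᵥ (fun r => x (lg p r)) = lam • (fun r => x (lg p r)) := by
  funext r
  have := hx (Sum.inr ⟨p, r⟩)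
  rw [row_lg F x p r, h0] at this
  simpa [Matrix.mulVec, dotProduct] using this

theorem sing_zero (F : WF hL A) {lam : ℝ} {x} (hx : Ker A lam x) {p} (hp : Sing A lam p) :
    x (vv p.1) = 0 := by
  obtain ⟨u, hu, h⟩ := hp
  have hu0 : u ⟨0, hL p⟩ ≠ 0 := fun h0 => hu (leg_path F p u h h0)
  have e : ∀ r, A (lg p r) (vv p.1) * x (vv p.1) + (leg A p *ᵥ fun r => x (lg p r)) r
      = lam * x (lg p r) := by
    intro r
    have := hx (Sum.inr ⟨p, r⟩)
    rw [row_lg F x p r] at this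
    exact this
  have hsym : (leg A p)ᵀ = leg A p := by ext i j; exact F.symm _ _
  have e2 : u ⬝ᵥ (leg A p *ᵥ fun r => x (lg p r)) = lam * (u ⬝ᵥ fun r => x (lg p r)) := by
    rw [Matrix.dotProduct_mulVec, ← Matrix.mulVec_transpose, hsym, h, smul_dotProduct, smul_eq_mul]
  have e3 : ∑ r, u r * (A (lg p r) (vv p.1) * x (vv p.1)) = 0 := by
    have : ∀ r, u r * (A (lg p r) (vv p.1) * x (vv p.1)) =
        lam * (u r * x (lg p r)) - u r * (leg A p *ᵥ fun r => x (lg p r)) r := by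
      intro r; have := e r; linear_combination u r * this
    rw [Finset.sum_congr rfl fun r _ => this r, Finset.sum_sub_distrib, ← Finset.mul_sum]
    simp only [dotProduct] at e2
    rw [e2, sub_self]
  rw [Finset.sum_eq_single (⟨0, hL p⟩ : Fin (L p))] at e3
  · have := F.vl p
    rw [F.symm] at this
    simpa [hu0, this] using e3
  · intro r _ hr
    rw [F.symm, F.vl0 p.1 p r (Or.inr fun h => hr (Fin.ext h))]; simp
  · simp

theorem leg_zero (F : WF hL A) {lam : ℝ} {x} (hx : Ker A lam x) (p) (h0 : x (vv p.1) = 0)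
    (h : ¬ Sing A lam p ∨ x (lg p ⟨0, hL p⟩) = 0) (r) : x (lg p r) = 0 := by
  have e := leg_eig F hx p h0
  have : (fun r => x (lg p r)) = 0 := by
    rcases h with h | h
    · by_contra hne
      exact h ⟨_, hne, e⟩
    · exact leg_path F p _ e h
  exact congrFun this r

theorem branch_zero (F : WF hL A) {lam : ℝ} {x} (hx : Ker A lam x) (i) (h0 : x (vv i) = 0)
    (ha : x ax = 0) (h : ∃ j, ¬ Sing A lam (i, j) ∨ x (lg (i, j) ⟨0, hL _⟩) = 0) (j r) :
    x (lg (i, j) r) = 0 := by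
  obtain ⟨j0, hj⟩ := h
  have z := leg_zero F hx (i, j0) h0 hj
  have e := hx (Sum.inl i)
  rw [row_vv F x i, h0, ha, Fin.sum_univ_two] at e
  have n0 := F.vl (i, 0)
  have n1 := F.vl (i, 1)
  by_cases hjj : j = j0
  · subst hjj; exact z r
  · apply leg_zero F hx (i, j) h0 (Or.inr _)
    have z' := z ⟨0, hL _⟩
    fin_cases j <;> fin_cases j0 <;> simp_all

/-- cut `x` to branch `i` -/
def cut (i : Fin k) (x : WV k L → ℝ) : WV k L → ℝ
  | Sum.inl _ => 0
  | Sum.inr (Sum.inl j) => if j = i then x (vv j) else 0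
  | Sum.inr (Sum.inr q) => if q.1.1 = i then x (lg q.1 q.2) else 0

theorem cut_ker (F : WF hL A) {lam : ℝ} {x} (hx : Ker A lam x) (ha : x ax = 0) (i : Fin k) :
    Ker A lam (cut i x) := by
  rintro (j | ⟨p, r⟩)
  · have e := hx (Sum.inl j)
    rw [row_vv F] at e ⊢
    by_cases h : j = i
    · simpa [cut, h, ha] using e
    · simp [cut, h]
  · have e := hx (Sum.inr ⟨p, r⟩)
    rw [row_lg F] at e ⊢
    by_cases h : p.1 = i
    · simpa [cut, h] using e
    · simp [cut, h]

theorem ker_of_eig {lam : ℝ} {x} (h : A *ᵥ x = lam • x) : Ker A lam x := fun w => by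
  rw [h]; simp

/-- the special case -/
def Spec (A : Matrix (WV k L) (WV k L) ℝ) (lam : ℝ) : Prop :=
  ∃ y : WV k L → ℝ, Ker A lam y ∧ y ax = 0 ∧ (A *ᵥ y) ax ≠ 0

theorem spec_ax (F : WF hL A) {lam : ℝ} (hS : Spec A lam) {x} (hx : A *ᵥ x = lam • x) :
    x ax = 0 := by
  obtain ⟨y, hy, hy0, hne⟩ := hS
  have hsym : Aᵀ = A := by ext i j; exact F.symm _ _
  have e2 : x ⬝ᵥ (A *ᵥ y) = lam * (x ⬝ᵥ y) := by
    rw [Matrix.dotProduct_mulVec, ← Matrix.mulVec_transpose, hsym, hx, smul_dotProduct, smul_eq_mul]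
  simp only [dotProduct] at e2
  have e3 : ∑ w, x w * ((A *ᵥ y) w - lam * y w) = 0 := by
    simp only [mul_sub, Finset.sum_sub_distrib]
    rw [e2, Finset.mul_sum, sub_eq_zero]
    exact Finset.sum_congr rfl fun w _ => by ring
  rw [Finset.sum_eq_single (ax : WV k L)] at e3
  · rw [hy0, mul_zero, sub_zero] at e3
    exact (mul_eq_zero.1 e3).resolve_right hne
  · rintro (w | w) _ hw
    · exact absurd rfl hw
    · rw [hy w, sub_self, mul_zero]
  · simp

theorem nspec (F : WF hL A) {lam : ℝ} (hS : ¬ Spec A lam) {x} (hx : Ker A lam x)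
    (ha : x ax = 0) (i) : x (vv i) = 0 := by
  by_contra hne
  apply hS
  refine ⟨cut i x, cut_ker F hx ha i, rfl, ?_⟩
  rw [row_ax F]
  simp [cut, F.axv, hne]

theorem ext0 {x : WV k L → ℝ} (h0 : x ax = 0) (h1 : ∀ i, x (vv i) = 0)
    (h2 : ∀ i j r, x (lg (i, j) r) = 0) : x = 0 := by
  funext w
  rcases w with u | i | ⟨⟨i, j⟩, r⟩
  · exact h0
  · exact h1 i
  · exact h2 i j r

def Full (A : Matrix (WV k L) (WV k L) ℝ) (lam : ℝ) (i : Fin k) : Prop :=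
  ∀ j, Sing A lam (i, j)

open Classical in
theorem bound_nspec (F : WF hL A) {lam : ℝ} (hS : ¬ Spec A lam) :
    A.charpoly.rootMultiplicity lam ≤ (Finset.univ.filter (Full A lam)).card + 1 := by
  have := mult_le (ι := Option {i // Full A lam i}) A (by ext i j; exact F.symm _ _) lam
    (fun o => match o with
      | none => LinearMap.proj ax
      | some i => LinearMap.proj (lg (i.1, 0) ⟨0, hL _⟩)) (by
    intro x hx h
    have ha : x ax = 0 := h none
    have hK := ker_of_eig hx
    have hv := nspec F hS hK ha
    refine ext0 ha hv fun i => branch_zero F hK i (hv i) ha ?_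
    by_cases hi : Full A lam i
    · exact ⟨0, Or.inr (h (some ⟨i, hi⟩))⟩
    · rw [Full, not_forall] at hi
      obtain ⟨j, hj⟩ := hi
      exact ⟨j, Or.inl hj⟩)
  rwa [Fintype.card_option, Fintype.card_subtype] at this

open Classical in
theorem bound_spec (F : WF hL A) {lam : ℝ} (hS : Spec A lam) :
    A.charpoly.rootMultiplicity lam ≤ k - 1 := by
  obtain ⟨y, hy, hy0, hne⟩ := id hS
  rw [row_ax F, hy0, mul_zero, zero_add] at hne
  obtain ⟨t, -, ht⟩ := Finset.exists_ne_zero_of_sum_ne_zero hne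
  have hyt : y (vv t) ≠ 0 := fun h => ht (by rw [h, mul_zero])
  have hnf : ¬ Full A lam t := fun h => hyt (sing_zero F hy (h 0))
  have := mult_le (ι := {i // i ≠ t}) A (by ext i j; exact F.symm _ _) lam
    (fun i => if Full A lam i.1 then LinearMap.proj (lg (i.1, 0) ⟨0, hL _⟩)
      else LinearMap.proj (vv i.1)) (by
    intro x hx h
    have ha : x ax = 0 := spec_ax F hS hx
    have hK := ker_of_eig hx
    have hv1 : ∀ i, i ≠ t → x (vv i) = 0 := by
      intro i hi
      by_cases hf : Full A lam i
      · exact sing_zero F hK (hf 0)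
      · have := h ⟨i, hi⟩
        simpa [hf] using this
    have hv : ∀ i, x (vv i) = 0 := by
      intro i
      by_cases hi : i = t
      · subst hi
        have e := congrFun hx ax
        rw [row_ax F, Finset.sum_eq_single i (fun j _ hj => by rw [hv1 j hj, mul_zero])
          (by simp)] at e
        simpa [ha, F.axv] using e
      · exact hv1 i hi
    refine ext0 ha hv fun i => branch_zero F hK i (hv i) ha ?_
    by_cases hi : Full A lam i
    · have hit : i ≠ t := fun h => hnf (h ▸ hi)
      have := h ⟨i, hit⟩
      exact ⟨0, Or.inr (by simpa [hi] using this)⟩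
    · rw [Full, not_forall] at hi
      obtain ⟨j, hj⟩ := hi
      exact ⟨j, Or.inl hj⟩)
  simpa [Fintype.card_subtype_compl] using this

end
end WhirlAux

/-- Let `W` be a generalized `k`-whirl (`k ≥ 2`) on `n` vertices with `2k` legs
`α^i_j`, each with at least one vertex, let `A` be a real symmetric matrix with graph `W`,
and let `A'` be the direct sum of the principal submatrices `A[α^i_j]` of `A` on the legs
(so that `m_{A'}(λ)` is the sum over the legs of the multiplicities of `λ`).  Then:
(i) if `m_A(λ) = k + 1`, then `λ` is a simple eigenvalue of `A[α^i_j]` for every leg and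
`m_{A'}(λ) = 2k`; and (ii) if `m_A(μ) = k`, then for all `i ≠ s` and all `j, t`, `μ` is a
simple eigenvalue of at least one of `A[α^i_j]`, `A[α^s_t]`, and `m_{A'}(μ) ≥ 2k - 2`. -/
theorem genWhirl_legs_multiplicities (k : ℕ) (hk : 2 ≤ k)
    (L : Fin k × Fin 2 → ℕ) (hL : ∀ p, 1 ≤ L p)
    (A : Matrix (Unit ⊕ Fin k ⊕ ((p : Fin k × Fin 2) × Fin (L p)))
                (Unit ⊕ Fin k ⊕ ((p : Fin k × Fin 2) × Fin (L p))) ℝ)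
    (hA : A.IsSymm) (hG : graphOf A = genWhirl k L) :
    (∀ lam : ℝ, A.charpoly.rootMultiplicity lam = k + 1 →
      (∀ p : Fin k × Fin 2,
        ((A.submatrix
            (fun r : Fin (L p) => (Sum.inr (Sum.inr ⟨p, r⟩) : _))
            (fun r : Fin (L p) => (Sum.inr (Sum.inr ⟨p, r⟩) : _))).charpoly).rootMultiplicity
          lam = 1) ∧
      (∑ p : Fin k × Fin 2,
        ((A.submatrix
            (fun r : Fin (L p) => (Sum.inr (Sum.inr ⟨p, r⟩) : _))
            (fun r : Fin (L p) => (Sum.inr (Sum.inr ⟨p, r⟩) : _))).charpoly).rootMultiplicity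
          lam) = 2 * k) ∧
    (∀ mu : ℝ, A.charpoly.rootMultiplicity mu = k →
      (∀ i s : Fin k, i ≠ s → ∀ j t : Fin 2,
        ((A.submatrix
            (fun r : Fin (L (i, j)) => (Sum.inr (Sum.inr ⟨(i, j), r⟩) : _))
            (fun r : Fin (L (i, j))  => (Sum.inr (Sum.inr ⟨(i, j), r⟩) : _))).charpoly).rootMultiplicity
          mu = 1 ∨
        ((A.submatrix
            (fun r : Fin (L (s, t)) => (Sum.inr (Sum.inr ⟨(s, t), r⟩) : _))
            (fun r : Fin (L (s, t)) => (Sum.inr (Sum.inr ⟨(s, t), r⟩) : _))).charpoly).rootMultiplicity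
          mu = 1) ∧
      2 * k - 2 ≤ ∑ p : Fin k × Fin 2,
        ((A.submatrix
            (fun r : Fin (L p) => (Sum.inr (Sum.inr ⟨p, r⟩) : _))
            (fun r : Fin (L p) => (Sum.inr (Sum.inr ⟨p, r⟩) : _))).charpoly).rootMultiplicity
          mu) := by
  classical
  have F := WhirlAux.mkWF hL A hA hG
  have main : ∀ lam : ℝ, k ≤ A.charpoly.rootMultiplicity lam →
      A.charpoly.rootMultiplicity lam ≤ (Finset.univ.filter (WhirlAux.Full A lam)).card + 1 := by
    intro lam h
    apply WhirlAux.bound_nspec F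
    intro hS
    have := WhirlAux.bound_spec F hS
    omega
  constructor
  · intro lam h
    have h1 := main lam (by omega)
    have h2 : Finset.univ.filter (WhirlAux.Full A lam) = Finset.univ := by
      apply Finset.eq_univ_of_card
      have := Finset.card_le_univ (Finset.univ.filter (WhirlAux.Full A lam))
      rw [Fintype.card_fin] at *
      omega
    have h3 : ∀ p : Fin k × Fin 2, (WhirlAux.leg A p).charpoly.rootMultiplicity lam = 1 := by
      rintro ⟨i, j⟩
      have : i ∈ Finset.univ.filter (WhirlAux.Full A lam) := by rw [h2]; simp
      exact WhirlAux.leg_mult F ((Finset.mem_filter.1 this).2 j)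
    refine ⟨h3, ?_⟩
    rw [Finset.sum_congr rfl fun p _ => h3 p]
    simp [mul_comm]
  · intro mu h
    have h1 := main mu (by omega)
    rw [h] at h1
    have h3 : ∀ i, WhirlAux.Full A mu i → ∀ j, (WhirlAux.leg A (i, j)).charpoly.rootMultiplicity mu = 1 :=
      fun i hi j => WhirlAux.leg_mult F (hi j)
    constructor
    · intro i s his j t
      by_cases hi : WhirlAux.Full A mu i
      · exact Or.inl (h3 i hi j)
      by_cases hs : WhirlAux.Full A mu s
      · exact Or.inr (h3 s hs t)
      exfalso
      have hsub : Finset.univ.filter (WhirlAux.Full A mu) ⊆ Finset.univ \ {i, s} := by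
        intro a ha
        have ha' := (Finset.mem_filter.1 ha).2
        simp only [Finset.mem_sdiff, Finset.mem_univ, true_and, Finset.mem_insert,
          Finset.mem_singleton, not_or]
        exact ⟨fun e => hi (e ▸ ha'), fun e => hs (e ▸ ha')⟩
      have hc := Finset.card_le_card hsub
      rw [Finset.card_sdiff_of_subset (Finset.subset_univ _), Finset.card_pair his,
        Finset.card_univ, Fintype.card_fin] at hc
      omega
    · change 2 * k - 2 ≤ ∑ p : Fin k × Fin 2, (WhirlAux.leg A p).charpoly.rootMultiplicity mu
      rw [Fintype.sum_prod_type]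
      have : ∑ i ∈ Finset.univ.filter (WhirlAux.Full A mu), 2 ≤
          ∑ i : Fin k, ∑ j : Fin 2, (WhirlAux.leg A (i, j)).charpoly.rootMultiplicity mu := by
        refine le_trans (Finset.sum_le_sum fun i hi => ?_)
          (Finset.sum_le_sum_of_subset (Finset.subset_univ _))
        rw [Finset.sum_congr rfl fun j _ => h3 i (Finset.mem_filter.1 hi).2 j]
        simp
      rw [Finset.sum_const, smul_eq_mul] at this
      omega
end

section
/- Let W be the (k,ℓ)-whirl with k ≥ 3 and ℓ ≥ 2. Then the minimum number q(W) of distinct eigenvalues over all real symmetric matrices whose graph is W satisfies q(W) ≥ d(W) + 1 + (k−2)(ℓ−1)/(k−1)² > d(W) + 1, where d(W) = 2ℓ + 2 is the diameter of W. -/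
open Polynomial Matrix

/-- The `(k,ℓ)`-whirl: the generalized `k`-whirl all of whose `2k` legs have `ℓ`
vertices; it has `2kℓ + k + 1` vertices and diameter `2ℓ + 2`. -/
def whirl (k ℓ : ℕ) : SimpleGraph (Unit ⊕ Fin k ⊕ ((p : Fin k × Fin 2) × Fin ℓ)) :=
  genWhirl k (fun _ => ℓ)

/-- `q(G)`: the minimum number of distinct eigenvalues over all real symmetric matrices
whose graph is `G`. -/
noncomputable def minDistinctEigen {V : Type*} [Fintype V] [DecidableEq V]
    (G : SimpleGraph V) : ℕ :=
  sInf {q | ∃ A : Matrix V V ℝ, A.IsSymm ∧ graphOf A = G ∧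
    q = A.charpoly.roots.toFinset.card}


namespace WhirlPf

set_option linter.unusedSectionVars false

abbrev Eig {n : Type*} [Fintype n] [DecidableEq n] (X : Matrix n n ℝ) (l : ℝ) :
    Submodule ℝ (n → ℝ) := Module.End.eigenspace (Matrix.toLin' X) l

section gen
variable {n : Type*} [Fintype n] [DecidableEq n]

noncomputable abbrev Sp (X : Matrix n n ℝ) : Finset ℝ := X.charpoly.roots.toFinset

lemma mem_Eig {X : Matrix n n ℝ} {l : ℝ} {x : n → ℝ} : x ∈ Eig X l ↔ X *ᵥ x = l • x := by
  rw [Module.End.mem_eigenspace_iff, Matrix.toLin'_apply]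

lemma symm_dot {X : Matrix n n ℝ} (hX : X.IsSymm) (x y : n → ℝ) :
    x ⬝ᵥ X *ᵥ y = (X *ᵥ x) ⬝ᵥ y := by
  rw [Matrix.dotProduct_mulVec, ← Matrix.mulVec_transpose, hX.eq]

lemma mem_Sp {X : Matrix n n ℝ} {l : ℝ} : l ∈ Sp X ↔ ∃ x : n → ℝ, x ≠ 0 ∧ X *ᵥ x = l • x := by
  have h1 : l ∈ Sp X ↔ Module.End.HasEigenvalue (Matrix.toLin' X) l := by
    rw [Module.End.hasEigenvalue_iff_isRoot_charpoly, Matrix.charpoly_toLin',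
      Multiset.mem_toFinset, Polynomial.mem_roots (Matrix.charpoly_monic X).ne_zero]
  rw [h1]
  constructor
  · intro h
    obtain ⟨x, hx⟩ := h.exists_hasEigenvector
    exact ⟨x, hx.2, mem_Eig.1 hx.1⟩
  · rintro ⟨x, hx, h⟩
    exact Module.End.hasEigenvalue_of_hasEigenvector ⟨mem_Eig.2 h, hx⟩

lemma maxGen_eq {X : Matrix n n ℝ} (hX : X.IsSymm) (l : ℝ) :
    Module.End.maxGenEigenspace (Matrix.toLin' X) l = Eig X l := by
  apply le_antisymm
  · intro x hx
    rw [Module.End.mem_maxGenEigenspace] at hx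
    obtain ⟨k, hk⟩ := hx
    have key : ∀ k, ∀ x : n → ℝ,
        ((Matrix.toLin' X - l • (1 : Module.End ℝ (n → ℝ))) ^ k) x = 0 → x ∈ Eig X l := by
      intro k
      induction k with
      | zero => intro x hx; simp at hx; simp [hx]
      | succ k ih =>
        intro x hx
        rw [pow_succ, Module.End.mul_apply] at hx
        have h2 := ih _ hx
        set y := (Matrix.toLin' X - l • (1 : Module.End ℝ (n → ℝ))) x with hy
        have hy' : y = X *ᵥ x - l • x := by simp [hy]
        have h3 := mem_Eig.1 h2
        have : y ⬝ᵥ y = 0 := by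
          have e : (X *ᵥ x - l • x) ⬝ᵥ y = 0 := by
            rw [sub_dotProduct, ← symm_dot hX, h3]; simp
          rwa [← hy'] at e
        have hy0 : y = 0 := dotProduct_self_eq_zero.1 this
        rw [mem_Eig]
        rw [hy'] at hy0
        exact sub_eq_zero.1 hy0
    exact key k x hk
  · exact Module.End.genEigenspace_le_maximal _ _ _

lemma herm {X : Matrix n n ℝ} (hX : X.IsSymm) : X.IsHermitian := by
  rw [Matrix.IsHermitian, Matrix.conjTranspose_eq_transpose_of_trivial, hX.eq]

lemma sum_finrank {X : Matrix n n ℝ} (hX : X.IsSymm) :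
    ∑ l ∈ Sp X, Module.finrank ℝ (Eig X l) = Fintype.card n := by
  have h : ∀ l, Module.finrank ℝ (Eig X l) = X.charpoly.roots.count l := by
    intro l
    rw [← maxGen_eq hX, LinearMap.finrank_maxGenEigenspace_eq, Matrix.charpoly_toLin',
      Polynomial.count_roots]
  simp_rw [h]
  rw [Multiset.toFinset_sum_count_eq]
  rw [(herm hX).roots_charpoly_eq_eigenvalues]
  simp

lemma card_Sp_le (X : Matrix n n ℝ) : (Sp X).card ≤ Fintype.card n := by
  calc _ ≤ X.charpoly.roots.card := Multiset.toFinset_card_le _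
    _ ≤ X.charpoly.natDegree := Polynomial.card_roots' _
    _ = _ := X.charpoly_natDegree_eq_dim

lemma psd_aux {X : Matrix n n ℝ} (hX : X.IsSymm) (h : ∀ m ∈ Sp X, 0 ≤ m) (y : n → ℝ)
    (hy : y ⬝ᵥ X *ᵥ y = 0) : X *ᵥ y = 0 := by
  have hp : X.PosSemidef := by
    rw [(herm hX).posSemidef_iff_eigenvalues_nonneg]
    intro i
    apply h
    rw [Multiset.mem_toFinset, (herm hX).roots_charpoly_eq_eigenvalues]
    simp
  have := (hp.dotProduct_mulVec_zero_iff y).1 (by simpa using hy)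
  exact this

lemma exists_gt {X : Matrix n n ℝ} (hX : X.IsSymm) (l : ℝ) (y : n → ℝ)
    (hy : y ⬝ᵥ X *ᵥ y = l * (y ⬝ᵥ y)) (hne : X *ᵥ y ≠ l • y) :
    (∃ m ∈ Sp X, l < m) ∧ (∃ m ∈ Sp X, m < l) := by
  constructor
  · by_contra! hc
    apply hne
    have := psd_aux (X := l • (1 : Matrix n n ℝ) - X)
      (by simp [Matrix.IsSymm, hX.eq]) (by
        intro m hm
        obtain ⟨x, hx, h⟩ := mem_Sp.1 hm
        have : l - m ∈ Sp X := mem_Sp.2 ⟨x, hx, by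
          rw [sub_smul, ← h, sub_mulVec, smul_mulVec, one_mulVec]; abel⟩
        linarith [hc _ this]) y (by
        rw [sub_mulVec, smul_mulVec, one_mulVec, dotProduct_sub, hy]; simp)
    rw [sub_mulVec, smul_mulVec, one_mulVec] at this
    exact (sub_eq_zero.1 this).symm
  · by_contra! hc
    apply hne
    have := psd_aux (X := X - l • (1 : Matrix n n ℝ))
      (by simp [Matrix.IsSymm, hX.eq]) (by
        intro m hm
        obtain ⟨x, hx, h⟩ := mem_Sp.1 hm
        have : l + m ∈ Sp X := mem_Sp.2 ⟨x, hx, by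
          rw [add_smul, ← h, sub_mulVec, smul_mulVec, one_mulVec]; abel⟩
        linarith [hc _ this]) y (by
        rw [sub_mulVec, smul_mulVec, one_mulVec, dotProduct_sub, hy]; simp)
    rw [sub_mulVec, smul_mulVec, one_mulVec] at this
    exact sub_eq_zero.1 this

/-- extension by zero along an injection -/
lemma sum_extend {b : Type*} [Fintype b] (e : b → n) (he : Function.Injective e)
    (z : b → ℝ) (g : n → ℝ) :
    ∑ u, g u * Function.extend e z 0 u = ∑ i, g (e i) * z i := by
  have h1 : ∑ i, g (e i) * z i = ∑ u ∈ Finset.univ.image e, g u * Function.extend e z 0 u := by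
    rw [Finset.sum_image (by intro a _ c _ h; exact he h)]
    simp [he.extend_apply]
  rw [h1]
  symm
  apply Finset.sum_subset (Finset.subset_univ _)
  intro u _ hu
  rw [Function.extend_apply' _ _ _ (by rintro ⟨a, rfl⟩; simp at hu)]
  simp

lemma ext_gt {b : Type*} [Fintype b] [DecidableEq b] {X : Matrix n n ℝ} (hX : X.IsSymm)
    (e : b → n) (he : Function.Injective e) (l : ℝ) (z : b → ℝ)
    (hz : X.submatrix e e *ᵥ z = l • z) (u : n) (hu : u ∉ Set.range e)
    (hne : ∑ i, X u (e i) * z i ≠ 0) :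
    (∃ m ∈ Sp X, l < m) ∧ (∃ m ∈ Sp X, m < l) := by
  have hmul : ∀ w, (X *ᵥ Function.extend e z 0) w = ∑ i, X w (e i) * z i := by
    intro w
    exact sum_extend e he z (fun u => X w u)
  apply exists_gt hX l (Function.extend e z 0)
  · rw [dotProduct_comm]
    rw [dotProduct, dotProduct, sum_extend e he z, sum_extend e he z]
    rw [Finset.mul_sum]
    apply Finset.sum_congr rfl
    intro i _
    have := congrFun hz i
    rw [hmul, he.extend_apply]
    simp only [mulVec, dotProduct, submatrix_apply, Pi.smul_apply, smul_eq_mul] at this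
    rw [this]; ring
  · intro h
    have := congrFun h u
    rw [hmul] at this
    rw [this] at hne
    apply hne
    rw [Pi.smul_apply, Function.extend_apply' _ _ _ (by simpa using hu)]
    simp

end gen
lemma counting (k l : ℕ) (hk : 3 ≤ k) (La : Finset ℝ) (N U : Fin k → Finset ℝ)
    (hUN : ∀ i, U i ⊆ N i) (hN : ∀ i, (N i).card = 2 * l + 1) (hU : ∀ i, (U i).card ≤ l)
    (m c : ℝ → ℕ) (d : ℝ) (hc : ∀ x, c x = (Finset.univ.filter (fun i => x ∈ N i)).card)
    (hm : ∑ x ∈ La, m x = k * (2 * l + 1) + 1)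
    (h1 : ∀ i x, x ∈ N i → x ∉ U i → m x + 1 ≤ c x)
    (h2 : ∀ x, m x ≤ c x + 1)
    (h2' : ∀ x, 1 ≤ m x → x ∈ La)
    (h3 : ∀ x, c x = k → m x = k + 1 → x = d)
    (h4 : ∀ x, 2 ≤ c x → x ∈ La)
    (h5 : ∀ i x, x ∈ U i → x ∈ La)
    (h6 : ∃ x ∈ La, ∃ y ∈ La, x ≠ y ∧ c x = 0 ∧ c y = 0)
    (h7 : ∀ x, x ∈ La → 1 ≤ m x) :
    ((k : ℚ) - 2) * ((l : ℚ) - 1) ≤ ((k : ℚ) - 1) ^ 2 * ((La.card : ℚ) - (2 * l + 3)) := by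
  classical
  set Om : Finset ℝ := La ∪ Finset.univ.biUnion N with hOm
  set t : ℝ → ℕ := fun x => (Finset.univ.filter (fun i => x ∈ N i ∧ x ∉ U i)).card with ht
  have hLaOm : La ⊆ Om := Finset.subset_union_left
  have hNOm : ∀ i, N i ⊆ Om := fun i =>
    (Finset.subset_biUnion_of_mem N (Finset.mem_univ i)).trans Finset.subset_union_right
  have sumc : ∑ x ∈ Om, c x = k * (2 * l + 1) := by
    simp_rw [hc, Finset.card_filter]
    rw [Finset.sum_comm]
    have : ∀ i, ∑ x ∈ Om, (if x ∈ N i then 1 else 0) = 2 * l + 1 := by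
      intro i
      rw [← Finset.card_filter, Finset.filter_mem_eq_inter, Finset.inter_eq_right.2 (hNOm i), hN]
    simp [this]
  have sumt : k * (l + 1) ≤ ∑ x ∈ Om, t x := by
    simp_rw [ht, Finset.card_filter]
    rw [Finset.sum_comm]
    have : ∀ i, l + 1 ≤ ∑ x ∈ Om, (if x ∈ N i ∧ x ∉ U i then 1 else 0) := by
      intro i
      rw [← Finset.card_filter]
      have : Om.filter (fun x => x ∈ N i ∧ x ∉ U i) = N i \ U i := by
        ext x; simp only [Finset.mem_filter, Finset.mem_sdiff]
        exact ⟨fun h => h.2, fun h => ⟨hNOm i h.1, h⟩⟩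
      rw [this, Finset.card_sdiff_of_subset (hUN i), hN]
      have := hU i
      omega
    calc k * (l + 1) = ∑ i : Fin k, (l + 1) := by simp
      _ ≤ _ := Finset.sum_le_sum fun i _ => this i
  have htc : ∀ x, t x ≤ c x := by
    intro x; rw [hc]; apply Finset.card_le_card; intro i; simp; tauto
  have hck : ∀ x, c x ≤ k := by
    intro x; rw [hc]; exact (Finset.card_le_univ _).trans (by simp)
  have ht1 : ∀ x, 1 ≤ t x → m x + 1 ≤ c x := by
    intro x hx
    obtain ⟨i, hi⟩ := Finset.card_pos.1 hx
    simp at hi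
    exact h1 i x hi.1 hi.2
  have ht0 : ∀ x, t x = 0 → 1 ≤ c x → x ∈ La := by
    intro x hx hcx
    rw [hc] at hcx
    obtain ⟨i, hi⟩ := Finset.card_pos.1 hcx
    simp at hi
    by_cases hiu : x ∈ U i
    · exact h5 i x hiu
    · exfalso
      have : i ∈ (Finset.univ.filter (fun i => x ∈ N i ∧ x ∉ U i)) := by simp [hi, hiu]
      rw [Finset.card_eq_zero.1 hx] at this
      simp at this
  have summ : ∑ x ∈ Om, m x = k * (2 * l + 1) + 1 := by
    rw [← hm]; symm
    apply Finset.sum_subset hLaOm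
    intro x _ hx
    by_contra h
    exact hx (h2' x (by omega))
  let X := (Om.filter (fun x => 1 ≤ t x ∧ c x = 1)).card
  let Y := (Om.filter (fun x => 1 ≤ t x ∧ 2 ≤ c x)).card
  let P := (Om.filter (fun x => c x < m x)).card
  let S := (Om.filter (fun x => c x < m x ∧ 1 ≤ c x)).card
  let R := (Om.filter (fun x => t x = 0 ∧ 1 ≤ c x ∧ m x ≤ c x)).card
  let D := (Om.filter (fun x => x = d)).card
  have hD : D ≤ 1 := by
    apply Finset.card_le_one.2; intro a ha b hb; simp at ha hb; rw [ha.2, hb.2]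
  have i1 : k * (2 * l + 1) + 1 + X + Y ≤ k * (2 * l + 1) + P := by
    rw [← summ]; conv_rhs => rw [← sumc]
    simp only [X, Y, P, Finset.card_filter]
    rw [← Finset.sum_add_distrib, ← Finset.sum_add_distrib, ← Finset.sum_add_distrib]
    apply Finset.sum_le_sum
    intro x _
    have a1 := ht1 x
    have a2 := h2 x
    have a3 := htc x
    split_ifs <;> omega
  have i2 : P + Y + R ≤ La.card := by
    have : La.card = ∑ x ∈ Om, if x ∈ La then 1 else 0 := by
      rw [← Finset.card_filter, Finset.filter_mem_eq_inter, Finset.inter_eq_right.2 hLaOm]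
    rw [this]
    simp only [Y, P, R, Finset.card_filter]
    rw [← Finset.sum_add_distrib, ← Finset.sum_add_distrib]
    apply Finset.sum_le_sum
    intro x _
    have a1 := ht1 x
    have a2 := h2' x
    have a3 := htc x
    have a4 := h4 x
    have a5 := ht0 x
    by_cases hx : x ∈ La
    · simp only [hx, if_true]; split_ifs <;> omega
    · simp only [hx, imp_false] at a2 a4 a5
      simp only [hx, if_false]; split_ifs <;> omega
  have i3 : k * (2 * l + 1) ≤ X + k * Y + (k - 1) * S + D + k * R := by
    rw [← sumc]
    simp only [X, Y, S, R, D, Finset.card_filter, Finset.mul_sum]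
    rw [← Finset.sum_add_distrib, ← Finset.sum_add_distrib, ← Finset.sum_add_distrib,
      ← Finset.sum_add_distrib]
    apply Finset.sum_le_sum
    intro x _
    have a1 := ht1 x
    have a2 := h2 x
    have a3 := htc x
    have a4 := h3 x
    have a5 := hck x
    by_cases hx : x = d
    · simp only [hx, if_true] at *; split_ifs <;> omega
    · simp only [hx, imp_false] at a4
      simp only [hx, if_false]; split_ifs <;> omega
  have i4 : S + 2 ≤ P := by
    obtain ⟨x, hx, y, hy, hxy, hcx, hcy⟩ := h6
    have e1 := h7 x hx
    have e2 := h7 y hy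
    have : S + ({x, y} : Finset ℝ).card ≤ P := by
      rw [← Finset.card_union_of_disjoint]
      · apply Finset.card_le_card
        intro z
        simp only [Finset.mem_union, Finset.mem_filter, Finset.mem_insert, Finset.mem_singleton]
        rintro (h | rfl | rfl)
        · exact ⟨h.1, h.2.1⟩
        · exact ⟨hLaOm hx, by omega⟩
        · exact ⟨hLaOm hy, by omega⟩
      · rw [Finset.disjoint_left]
        intro z
        simp only [Finset.mem_filter, Finset.mem_insert, Finset.mem_singleton]
        rintro h (rfl | rfl) <;> omega
    rwa [Finset.card_pair hxy] at this
  have i5 : k * (l + 1) ≤ X + k * Y := by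
    refine sumt.trans ?_
    simp only [X, Y, Finset.card_filter, Finset.mul_sum]
    rw [← Finset.sum_add_distrib]
    apply Finset.sum_le_sum
    intro x _
    have a3 := htc x
    have a5 := hck x
    split_ifs <;> omega
  clear_value X Y P S R D
  obtain ⟨k, rfl⟩ : ∃ k', k = k' + 1 := ⟨k - 1, by omega⟩
  simp only [Nat.add_sub_cancel] at i3
  generalize La.card = q at *
  have hk' : (2 : ℚ) ≤ k := by exact_mod_cast (by omega : 2 ≤ k)
  have j1 : (1 : ℚ) + X + Y ≤ P := by exact_mod_cast (by omega : 1 + X + Y ≤ P)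
  have j2 : (P : ℚ) + Y + R ≤ q := by exact_mod_cast i2
  have j3 : ((k : ℚ) + 1) * (2 * l + 1) ≤ X + (k + 1) * Y + k * S + D + (k + 1) * R := by
    exact_mod_cast i3
  have j4 : (S : ℚ) + 2 ≤ P := by exact_mod_cast i4
  have j5 : ((k : ℚ) + 1) * (l + 1) ≤ X + (k + 1) * Y := by exact_mod_cast i5
  have j6 : (D : ℚ) ≤ 1 := by exact_mod_cast hD
  push_cast
  have b1 : ((k : ℚ) + 1) * (2 * l + 3) + Y - 2 ≤ (k + 1) * q := by
    have := mul_le_mul_of_nonneg_left j2 (by linarith : (0 : ℚ) ≤ k + 1)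
    have := mul_le_mul_of_nonneg_left j4 (by linarith : (0 : ℚ) ≤ k)
    nlinarith
  have b2 : ((k : ℚ) + 1) * (2 * l + 3) + (k - 1) * X ≤ (k + 1) * q := by
    have := mul_le_mul_of_nonneg_left (by linarith [Nat.cast_nonneg (α := ℚ) R] : (1 : ℚ) + X + 2 * Y ≤ q) (by linarith : (0 : ℚ) ≤ k + 1)
    nlinarith
  set E : ℚ := q - (2 * l + 3) with hE
  have b1' : (Y : ℚ) - 2 ≤ (k + 1) * E := by rw [hE]; linarith
  have b2' : ((k : ℚ) - 1) * X ≤ (k + 1) * E := by rw [hE]; linarith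
  have b3 : ((k : ℚ) + 1) * (l - 1) - X ≤ (k + 1) * ((k + 1) * E) := by
    have := mul_le_mul_of_nonneg_left b1' (by linarith : (0 : ℚ) ≤ k + 1)
    linarith
  have b4 := mul_le_mul_of_nonneg_left b3 (by linarith : (0 : ℚ) ≤ k - 1)
  have b5 : (k + 1) * (((k : ℚ) - 1) * (l - 1)) ≤ (k + 1) * ((k : ℚ) ^ 2 * E) := by
    nlinarith
  have := le_of_mul_le_mul_left b5 (by linarith : (0 : ℚ) < k + 1)
  linear_combination this

abbrev Bt (l : ℕ) := Unit ⊕ Fin 2 × Fin l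

structure IsBr {l : ℕ} (B : Matrix (Bt l) (Bt l) ℝ) : Prop where
  symm : B.IsSymm
  h1 : ∀ j m, B (Sum.inl ()) (Sum.inr (j, m)) ≠ 0 ↔ (m : ℕ) = 0
  h2 : ∀ j j' m m', j ≠ j' → B (Sum.inr (j, m)) (Sum.inr (j', m')) = 0
  h3 : ∀ j m m', m ≠ m' → (B (Sum.inr (j, m)) (Sum.inr (j, m')) ≠ 0 ↔
    (m : ℕ) + 1 = m' ∨ (m' : ℕ) + 1 = m)

def lg {l : ℕ} (j : Fin 2) (m : Fin l) : Bt l := Sum.inr (j, m)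

lemma lg_inj {l : ℕ} (j : Fin 2) : Function.Injective (lg (l := l) j) := by
  intro a b h; simpa [lg] using h

section br
variable {l : ℕ} {B : Matrix (Bt l) (Bt l) ℝ}

lemma IsBr.row_leg (h : IsBr B) (z : Bt l → ℝ) (j : Fin 2) (m : Fin l) :
    (B *ᵥ z) (lg j m) = (B.submatrix (lg j) (lg j) *ᵥ (z ∘ lg j)) m
      + B (lg j m) (Sum.inl ()) * z (Sum.inl ()) := by
  simp only [mulVec, dotProduct, Fintype.sum_sum_type, Fintype.sum_prod_type, submatrix_apply,
    Function.comp]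
  rw [Finset.sum_eq_single j]
  · simp [lg]; ring
  · intro j' _ hj
    apply Finset.sum_eq_zero
    intro m' _
    rw [lg, h.h2 _ _ _ _ (Ne.symm hj), zero_mul]
  · simp

lemma IsBr.row_mid (h : IsBr B) (hl : 0 < l) (z : Bt l → ℝ) :
    (B *ᵥ z) (Sum.inl ()) = B (Sum.inl ()) (Sum.inl ()) * z (Sum.inl ())
      + ∑ j, B (Sum.inl ()) (lg j ⟨0, hl⟩) * z (lg j ⟨0, hl⟩) := by
  simp only [mulVec, dotProduct, Fintype.sum_sum_type, Fintype.sum_prod_type]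
  congr 1
  · simp
  · apply Finset.sum_congr rfl
    intro j _
    rw [Finset.sum_eq_single ⟨0, hl⟩]
    · rfl
    · intro m _ hm
      have : B (Sum.inl ()) (Sum.inr (j, m)) = 0 := by
        by_contra hc
        exact hm (Fin.ext ((h.h1 j m).1 hc))
      rw [this, zero_mul]
    · simp

lemma IsBr.path (h : IsBr B) (hl : 0 < l) (j : Fin 2) (x : ℝ) (w : Fin l → ℝ)
    (hw : B.submatrix (lg j) (lg j) *ᵥ w = x • w) (h0 : w ⟨0, hl⟩ = 0) : w = 0 := by
  have key : ∀ n : ℕ, ∀ m : Fin l, (m : ℕ) ≤ n → w m = 0 := by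
    intro n
    induction n with
    | zero =>
      intro m hm
      have : m = ⟨0, hl⟩ := Fin.ext (by simpa using hm)
      rw [this, h0]
    | succ n ih =>
      intro m hm
      rcases Nat.lt_or_ge (m : ℕ) (n + 1) with hlt | hge
      · exact ih m (by omega)
      · have hmn : (m : ℕ) = n + 1 := by omega
        let p : Fin l := ⟨n, by omega⟩
        have e := congrFun hw p
        simp only [mulVec, dotProduct, Pi.smul_apply, smul_eq_mul, submatrix_apply] at e
        rw [ih p (by simp [p]), mul_zero, Finset.sum_eq_single m] at e
        · rcases mul_eq_zero.1 e with e | e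
          · exfalso
            exact (h.h3 j p m (by intro hh; rw [← hh] at hmn; simp [p] at hmn)).2
              (Or.inl (by simp [p, hmn])) e
          · exact e
        · intro m' _ hm'
          by_cases hle : (m' : ℕ) ≤ n
          · rw [ih m' hle, mul_zero]
          · have hne : p ≠ m' := by
              intro hh; rw [← hh] at hle; simp [p] at hle
            have : B (lg j p) (lg j m') = 0 := by
              by_contra hc
              have := (h.h3 j p m' hne).1 hc
              have hne2 : (m' : ℕ) ≠ m := fun hh => hm' (Fin.ext hh)
              simp [p] at this
              omega
            rw [this, zero_mul]
        · simp
  funext m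
  exact key m m le_rfl

lemma IsBr.pair (h : IsBr B) (hl : 0 < l) (j : Fin 2) (x : ℝ) (w : Fin l → ℝ)
    (hw : B.submatrix (lg j) (lg j) *ᵥ w = x • w) (hw0 : w ≠ 0) (z : Bt l → ℝ)
    (hz : ∀ m, (B *ᵥ z) (lg j m) = x * z (lg j m)) : z (Sum.inl ()) = 0 := by
  have hs : (B.submatrix (lg j) (lg j)).IsSymm := h.symm.submatrix _
  have e1 : w ⬝ᵥ (B.submatrix (lg j) (lg j) *ᵥ (z ∘ lg j)) = x * (w ⬝ᵥ (z ∘ lg j)) := by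
    rw [symm_dot hs, hw]; simp
  have e2 : B.submatrix (lg j) (lg j) *ᵥ (z ∘ lg j) =
      x • (z ∘ lg j) - fun m => B (lg j m) (Sum.inl ()) * z (Sum.inl ()) := by
    funext m
    have := h.row_leg z j m
    rw [hz] at this
    simp only [Pi.sub_apply, Pi.smul_apply, smul_eq_mul, Function.comp]
    linarith
  rw [e2, dotProduct_sub, dotProduct_smul, smul_eq_mul] at e1
  have e3 : ∑ m, w m * (B (lg j m) (Sum.inl ()) * z (Sum.inl ())) = 0 := by
    have : w ⬝ᵥ (fun m => B (lg j m) (Sum.inl ()) * z (Sum.inl ())) = 0 := by linarith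
    exact this
  rw [Finset.sum_eq_single ⟨0, hl⟩] at e3
  · have n1 : w ⟨0, hl⟩ ≠ 0 := fun hh => hw0 (h.path hl j x w hw hh)
    have n2 : B (lg j ⟨0, hl⟩) (Sum.inl ()) ≠ 0 := by
      rw [h.symm.apply]; exact (h.h1 j _).2 rfl
    rcases mul_eq_zero.1 e3 with e | e
    · exact absurd e n1
    · rcases mul_eq_zero.1 e with e | e
      · exact absurd e n2
      · exact e
  · intro m _ hm
    have : B (lg j m) (Sum.inl ()) = 0 := by
      rw [h.symm.apply]
      by_contra hc
      exact hm (Fin.ext ((h.h1 j m).1 hc))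
    rw [this]; ring
  · simp

lemma IsBr.leg_eig (h : IsBr B) (x : ℝ) (z : Bt l → ℝ) (hz : B *ᵥ z = x • z)
    (h0 : z (Sum.inl ()) = 0) (j : Fin 2) :
    B.submatrix (lg j) (lg j) *ᵥ (z ∘ lg j) = x • (z ∘ lg j) := by
  funext m
  have := h.row_leg z j m
  rw [hz, h0, mul_zero, add_zero] at this
  rw [← this]; rfl

lemma bt_zero (z : Bt l → ℝ) (h0 : z (Sum.inl ()) = 0) (h : ∀ j, z ∘ lg j = 0) : z = 0 := by
  funext b
  rcases b with ⟨⟩ | ⟨j, m⟩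
  · exact h0
  · exact congrFun (h j) m

lemma IsBr.eq_zero (h : IsBr B) (hl : 0 < l) (x : ℝ) (z : Bt l → ℝ) (hz : B *ᵥ z = x • z)
    (h0 : z (Sum.inl ()) = 0) (h1 : z (lg 0 ⟨0, hl⟩) = 0) : z = 0 := by
  have a0 := h.path hl 0 x _ (h.leg_eig x z hz h0 0) h1
  have e := h.row_mid hl z
  rw [hz] at e
  simp only [Pi.smul_apply, smul_eq_mul, h0, mul_zero, Fin.sum_univ_two, h1, zero_add] at e
  have e1 : z (lg 1 ⟨0, hl⟩) = 0 := by
    rcases mul_eq_zero.1 e.symm with e | e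
    · exact absurd e ((h.h1 1 ⟨0, hl⟩).2 rfl)
    · exact e
  have a1 := h.path hl 1 x _ (h.leg_eig x z hz h0 1) e1
  apply bt_zero z h0
  intro j
  fin_cases j
  · exact a0
  · exact a1

lemma finrank_le_one_of {E : Type*} [AddCommGroup E] [Module ℝ E] [FiniteDimensional ℝ E]
    (K : Submodule ℝ E) (f : E →ₗ[ℝ] ℝ) (hf : ∀ z ∈ K, f z = 0 → z = 0) :
    Module.finrank ℝ K ≤ 1 := by
  have : Function.Injective (f.domRestrict K) := by
    rw [injective_iff_map_eq_zero]
    intro z hz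
    exact Subtype.ext (hf z z.2 hz)
  simpa using LinearMap.finrank_le_finrank_of_injective this

lemma IsBr.finrank_le (h : IsBr B) (hl : 0 < l) (x : ℝ) : Module.finrank ℝ (Eig B x) ≤ 1 := by
  by_cases hc : ∃ z ∈ Eig B x, z (Sum.inl ()) ≠ 0
  · obtain ⟨z, hz, hz0⟩ := hc
    rw [mem_Eig] at hz
    apply finrank_le_one_of _ (LinearMap.proj (Sum.inl ()))
    intro y hy hy0
    rw [mem_Eig] at hy
    apply bt_zero y hy0
    intro j
    by_contra hne
    exact hz0 (h.pair hl j x _ (h.leg_eig x y hy hy0 j) hne z (fun m => by rw [hz]; rfl))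
  · push Not at hc
    apply finrank_le_one_of _ (LinearMap.proj (lg 0 ⟨0, hl⟩))
    intro y hy hy0
    exact h.eq_zero hl x y (mem_Eig.1 hy) (hc y hy) hy0

lemma finrank_pos_iff {n : Type*} [Fintype n] [DecidableEq n] (X : Matrix n n ℝ) (x : ℝ) :
    1 ≤ Module.finrank ℝ (Eig X x) ↔ x ∈ Sp X := by
  rw [Nat.one_le_iff_ne_zero, Ne, Submodule.finrank_eq_zero, mem_Sp, Submodule.eq_bot_iff]
  push Not
  constructor
  · rintro ⟨z, hz, h0⟩; exact ⟨z, h0, mem_Eig.1 hz⟩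
  · rintro ⟨z, h0, hz⟩; exact ⟨z, mem_Eig.2 hz, h0⟩

open Classical in
lemma IsBr.finrank_eq (h : IsBr B) (hl : 0 < l) (x : ℝ) :
    Module.finrank ℝ (Eig B x) = if x ∈ Sp B then 1 else 0 := by
  have h1 := h.finrank_le hl x
  have h2 := finrank_pos_iff B x
  split_ifs with hx
  · have := h2.2 hx; omega
  · rw [← h2] at hx; omega

lemma IsBr.card_Sp (h : IsBr B) (hl : 0 < l) : (Sp B).card = 2 * l + 1 := by
  have := sum_finrank h.symm
  rw [Finset.sum_congr rfl (g := fun _ => 1)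
    (fun x hx => by rw [h.finrank_eq hl, if_pos hx])] at this
  simp at this
  omega

open Classical in
noncomputable def US (B : Matrix (Bt l) (Bt l) ℝ) : Finset ℝ :=
  (Sp B).filter (fun x => ∃ z : Bt l → ℝ, z ≠ 0 ∧ B *ᵥ z = x • z ∧ z (Sum.inl ()) = 0)

lemma mem_US {x : ℝ} : x ∈ US B ↔
    ∃ z : Bt l → ℝ, z ≠ 0 ∧ B *ᵥ z = x • z ∧ z (Sum.inl ()) = 0 := by
  simp only [US, Finset.mem_filter]
  rw [and_iff_right_iff_imp]
  rintro ⟨z, h0, hz, _⟩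
  exact mem_Sp.2 ⟨z, h0, hz⟩

lemma IsBr.US_leg (h : IsBr B) (hl : 0 < l) (x : ℝ) (hx : x ∈ US B) :
    ∃ w : Fin l → ℝ, w ≠ 0 ∧ B.submatrix (lg 0) (lg 0) *ᵥ w = x • w := by
  obtain ⟨z, h0, hz, h1⟩ := mem_US.1 hx
  refine ⟨z ∘ lg 0, ?_, h.leg_eig x z hz h1 0⟩
  intro hc
  exact h0 (h.eq_zero hl x z hz h1 (congrFun hc ⟨0, hl⟩))

lemma IsBr.card_US (h : IsBr B) (hl : 0 < l) : (US B).card ≤ l := by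
  calc (US B).card ≤ (Sp (B.submatrix (lg 0) (lg 0))).card := by
        apply Finset.card_le_card
        intro x hx
        exact mem_Sp.2 (h.US_leg hl x hx)
    _ ≤ Fintype.card (Fin l) := card_Sp_le _
    _ = l := by simp

end br
abbrev Vt (k l : ℕ) := Unit ⊕ Fin k ⊕ ((_p : Fin k × Fin 2) × Fin l)

def em {k l : ℕ} (i : Fin k) : Bt l → Vt k l
  | Sum.inl _ => Sum.inr (Sum.inl i)
  | Sum.inr q => Sum.inr (Sum.inr ⟨(i, q.1), q.2⟩)

abbrev ax {k l : ℕ} : Vt k l := Sum.inl ()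

lemma em_inj {k l : ℕ} (i : Fin k) : Function.Injective (em (l := l) i) := by
  rintro (⟨⟩ | ⟨j, m⟩) (⟨⟩ | ⟨j', m'⟩) h <;> simp_all [em]

lemma sumV {k l : ℕ} (g : Vt k l → ℝ) : ∑ u, g u = g ax + ∑ i, ∑ b, g (em i b) := by
  simp only [Fintype.sum_sum_type, Fintype.sum_sigma, Fintype.sum_prod_type, em,
    Finset.sum_add_distrib]
  simp [ax]

structure IsWh {k l : ℕ} (A : Matrix (Vt k l) (Vt k l) ℝ) : Prop where
  symm : A.IsSymm
  h0 : ∀ i, A ax (em i (Sum.inl ())) ≠ 0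
  h0' : ∀ i q, A ax (em i (Sum.inr q)) = 0
  hz : ∀ i i' b b', i ≠ i' → A (em i b) (em i' b') = 0
  br : ∀ i, IsBr (A.submatrix (em i) (em i))

section wh
variable {k l : ℕ} {A : Matrix (Vt k l) (Vt k l) ℝ}

abbrev Br (A : Matrix (Vt k l) (Vt k l) ℝ) (i : Fin k) : Matrix (Bt l) (Bt l) ℝ :=
  A.submatrix (em i) (em i)

lemma IsWh.row_br (h : IsWh A) (x : Vt k l → ℝ) (i : Fin k) (b : Bt l) :
    (A *ᵥ x) (em i b) = (Br A i *ᵥ (x ∘ em i)) b + A (em i b) ax * x ax := by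
  simp only [mulVec, dotProduct]
  rw [sumV, Finset.sum_eq_single i]
  · simp only [submatrix_apply, Function.comp]; ring
  · intro i' _ hi
    apply Finset.sum_eq_zero
    intro b' _
    rw [h.hz _ _ _ _ (Ne.symm hi), zero_mul]
  · simp

lemma IsWh.ax_sum (h : IsWh A) (i : Fin k) (z : Bt l → ℝ) :
    ∑ b, A ax (em i b) * z b = A ax (em i (Sum.inl ())) * z (Sum.inl ()) := by
  rw [Fintype.sum_sum_type]
  simp [h.h0']

lemma IsWh.row_ax (h : IsWh A) (x : Vt k l → ℝ) :
    (A *ᵥ x) ax = A ax ax * x ax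
      + ∑ i, A ax (em i (Sum.inl ())) * x (em i (Sum.inl ())) := by
  simp only [mulVec, dotProduct]
  rw [sumV]
  congr 1
  apply Finset.sum_congr rfl
  intro i _
  exact h.ax_sum i (x ∘ em i)

lemma V_zero (x : Vt k l → ℝ) (h0 : x ax = 0) (h : ∀ i, x ∘ em i = 0) : x = 0 := by
  funext u
  rcases u with ⟨⟩ | i | ⟨⟨i, j⟩, m⟩
  · exact h0
  · exact congrFun (h i) (Sum.inl ())
  · exact congrFun (h i) (Sum.inr (j, m))

/-- restriction to branches -/
noncomputable def resMap (h : IsWh A) (x : ℝ) (H : Submodule ℝ (Vt k l → ℝ)) (hH : H ≤ Eig A x)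
    (h0 : ∀ y ∈ H, y ax = 0) : H →ₗ[ℝ] (∀ i, Eig (Br A i) x) :=
  LinearMap.pi fun i => LinearMap.codRestrict _
    ((LinearMap.funLeft ℝ ℝ (em i)).domRestrict H) (by
      intro y
      rw [mem_Eig]
      funext b
      have e := h.row_br y.1 i b
      rw [mem_Eig.1 (hH y.2), h0 _ y.2, mul_zero, add_zero] at e
      exact e.symm)

lemma resMap_inj (h : IsWh A) (x : ℝ) (H : Submodule ℝ (Vt k l → ℝ)) (hH : H ≤ Eig A x)
    (h0 : ∀ y ∈ H, y ax = 0) : Function.Injective (resMap h x H hH h0) := by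
  rw [injective_iff_map_eq_zero]
  intro y hy
  apply Subtype.ext
  apply V_zero _ (h0 _ y.2)
  intro i
  exact congrArg Subtype.val (congrFun hy i)

noncomputable def cc (A : Matrix (Vt k l) (Vt k l) ℝ) (x : ℝ) : ℕ :=
  Module.finrank ℝ (∀ i, Eig (Br A i) x)

lemma cc_eq (h : IsWh A) (hl : 0 < l) (x : ℝ) :
    cc A x = (Finset.univ.filter (fun i => x ∈ Sp (Br A i))).card := by
  classical
  rw [cc, Module.finrank_pi_fintype, Finset.card_filter]
  apply Finset.sum_congr rfl
  intro i _
  rw [(h.br i).finrank_eq hl]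

noncomputable def psi (A : Matrix (Vt k l) (Vt k l) ℝ) (x : ℝ) :
    (∀ i, Eig (Br A i) x) →ₗ[ℝ] ℝ :=
  ∑ i, A ax (em i (Sum.inl ())) •
    ((LinearMap.proj (Sum.inl ())).comp ((Eig (Br A i) x).subtype.comp (LinearMap.proj i)))

lemma psi_apply (x : ℝ) (y : ∀ i, Eig (Br A i) x) :
    psi A x y = ∑ i, A ax (em i (Sum.inl ())) * (y i).1 (Sum.inl ()) := by
  simp [psi]

lemma le_cc (h : IsWh A) (x : ℝ) (H : Submodule ℝ (Vt k l → ℝ)) (hH : H ≤ Eig A x)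
    (h0 : ∀ y ∈ H, y ax = 0) : Module.finrank ℝ H ≤ cc A x :=
  LinearMap.finrank_le_finrank_of_injective (resMap_inj h x H hH h0)

lemma wh_h2 (h : IsWh A) (x : ℝ) : Module.finrank ℝ (Eig A x) ≤ cc A x + 1 := by
  let f : (Vt k l → ℝ) →ₗ[ℝ] ℝ := LinearMap.proj ax
  let g := f.domRestrict (Eig A x)
  have e := LinearMap.finrank_range_add_finrank_ker g
  have e1 : Module.finrank ℝ (LinearMap.range g) ≤ 1 := by
    simpa using Submodule.finrank_le (LinearMap.range g)
  have e2 : Module.finrank ℝ (LinearMap.ker g) ≤ cc A x := by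
    have e3 := le_cc h x ((LinearMap.ker g).map (Eig A x).subtype) (by
      rintro y ⟨z, _, rfl⟩; exact z.2) (by
      rintro y ⟨z, hz, rfl⟩; exact hz)
    rwa [LinearEquiv.finrank_eq (Submodule.equivMapOfInjective _
      (Submodule.injective_subtype _) (LinearMap.ker g)).symm] at e3
  omega

lemma wh_ax (h : IsWh A) (x : ℝ) (i : Fin k) (hi : x ∈ Sp (Br A i)) (hU : x ∉ US (Br A i)) :
    (∃ z, Br A i *ᵥ z = x • z ∧ z (Sum.inl ()) ≠ 0) ∧ ∀ y ∈ Eig A x, y ax = 0 := by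
  obtain ⟨z, hz0, hz⟩ := mem_Sp.1 hi
  have hzn : z (Sum.inl ()) ≠ 0 := fun hc => hU (mem_US.2 ⟨z, hz0, hz, hc⟩)
  refine ⟨⟨z, hz, hzn⟩, ?_⟩
  intro y hy
  rw [mem_Eig] at hy
  have e1 : z ⬝ᵥ (Br A i *ᵥ (y ∘ em i)) = x * (z ⬝ᵥ (y ∘ em i)) := by
    rw [symm_dot (h.br i).symm, hz]; simp
  have e2 : Br A i *ᵥ (y ∘ em i) = x • (y ∘ em i) - fun b => A ax (em i b) * y ax := by
    funext b
    have := h.row_br y i b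
    rw [hy, h.symm.apply] at this
    simp only [Pi.sub_apply, Pi.smul_apply, smul_eq_mul, Function.comp] at this ⊢
    linarith
  rw [e2, dotProduct_sub, dotProduct_smul, smul_eq_mul] at e1
  have e3 : ∑ b, z b * (A ax (em i b) * y ax) = 0 := by
    have : z ⬝ᵥ (fun b => A ax (em i b) * y ax) = 0 := by linarith
    exact this
  have e4 : (∑ b, A ax (em i b) * z b) * y ax = 0 := by
    rw [← e3, Finset.sum_mul]
    apply Finset.sum_congr rfl
    intro b _; ring
  rw [h.ax_sum] at e4
  rcases mul_eq_zero.1 e4 with e | e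
  · exact absurd e (mul_ne_zero (h.h0 i) hzn)
  · exact e

lemma finrank_ker_psi (x : ℝ) : cc A x ≤ Module.finrank ℝ (LinearMap.ker (psi A x)) + 1 := by
  have e := LinearMap.finrank_range_add_finrank_ker (psi A x)
  have e1 : Module.finrank ℝ (LinearMap.range (psi A x)) ≤ 1 := by
    simpa using Submodule.finrank_le (LinearMap.range (psi A x))
  rw [cc]; omega

lemma wh_h1 (h : IsWh A) (x : ℝ) (i : Fin k) (hi : x ∈ Sp (Br A i)) (hU : x ∉ US (Br A i)) :
    Module.finrank ℝ (Eig A x) + 1 ≤ cc A x := by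
  classical
  obtain ⟨⟨z, hz, hzn⟩, h0⟩ := wh_ax h x i hi hU
  have inj := resMap_inj h x (Eig A x) le_rfl h0
  have e1 := LinearMap.finrank_range_of_inj inj
  have e2 : LinearMap.range (resMap h x (Eig A x) le_rfl h0) ≤ LinearMap.ker (psi A x) := by
    rintro _ ⟨y, rfl⟩
    rw [LinearMap.mem_ker, psi_apply]
    have e := h.row_ax y.1
    rw [mem_Eig.1 y.2] at e
    simp only [Pi.smul_apply, h0 _ y.2, smul_eq_mul, mul_zero, zero_add] at e
    exact e.symm
  have e3 := Submodule.finrank_mono e2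
  have e4 := LinearMap.finrank_range_add_finrank_ker (psi A x)
  have e5 : 1 ≤ Module.finrank ℝ (LinearMap.range (psi A x)) := by
    rw [Nat.one_le_iff_ne_zero, Ne, Submodule.finrank_eq_zero, LinearMap.range_eq_bot]
    intro hc
    have := psi_apply (A := A) x (Pi.single i ⟨z, mem_Eig.2 hz⟩)
    rw [hc, LinearMap.zero_apply, Finset.sum_eq_single i] at this
    · simp only [Pi.single_eq_same] at this
      exact mul_ne_zero (h.h0 i) hzn this.symm
    · intro j _ hj
      simp [Pi.single_eq_of_ne hj]
    · simp
  rw [cc]; omega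

def glue (y : Fin k → Bt l → ℝ) : Vt k l → ℝ
  | Sum.inl _ => 0
  | Sum.inr (Sum.inl i) => y i (Sum.inl ())
  | Sum.inr (Sum.inr q) => y q.1.1 (Sum.inr (q.1.2, q.2))

lemma glue_em (y : Fin k → Bt l → ℝ) (i : Fin k) : glue y ∘ em i = y i := by
  funext b; rcases b with ⟨⟩ | ⟨j, m⟩ <;> rfl

lemma wh_glue (h : IsWh A) (x : ℝ) (y : ∀ i, Eig (Br A i) x) (hy : y ≠ 0)
    (hp : psi A x y = 0) : x ∈ Sp A := by
  rw [mem_Sp]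
  refine ⟨glue (fun i => (y i).1), ?_, ?_⟩
  · intro hc
    apply hy
    funext i
    apply Subtype.ext
    rw [← glue_em (fun i => (y i).1) i, hc]; rfl
  · have key : ∀ i b, (A *ᵥ glue (fun i => (y i).1)) (em i b) =
        (x • glue (fun i => (y i).1)) (em i b) := by
      intro i b
      rw [h.row_br, glue_em, mem_Eig.1 (y i).2]
      have : glue (fun i => (y i).1) (ax : Vt k l) = 0 := rfl
      rw [this, mul_zero, add_zero]
      have := congrFun (glue_em (fun i => (y i).1) i) b
      simp only [Pi.smul_apply, ← this, Function.comp]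
    funext u
    rcases u with ⟨⟩ | i | ⟨⟨i, j⟩, m⟩
    · have e := h.row_ax (glue (fun i => (y i).1))
      rw [psi_apply] at hp
      have e0 : glue (fun i => (y i).1) (ax : Vt k l) = 0 := rfl
      have e1 : ∀ i, glue (fun i => (y i).1) (em i (Sum.inl ())) = (y i).1 (Sum.inl ()) :=
        fun i => rfl
      simp only [e1] at e
      rw [hp, e0, mul_zero, add_zero] at e
      rw [e, Pi.smul_apply, e0]; simp
    · exact key i (Sum.inl ())
    · exact key i (Sum.inr (j, m))

lemma wh_h4 (h : IsWh A) (x : ℝ) (hc : 2 ≤ cc A x) : x ∈ Sp A := by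
  have e := finrank_ker_psi (A := A) x
  have : LinearMap.ker (psi A x) ≠ ⊥ := by
    intro hb
    rw [← Submodule.finrank_eq_zero (R := ℝ)] at hb
    omega
  obtain ⟨y, hy, hy0⟩ := Submodule.exists_mem_ne_zero_of_ne_bot this
  exact wh_glue h x y hy0 hy

lemma wh_h5 (h : IsWh A) (x : ℝ) (i : Fin k) (hU : x ∈ US (Br A i)) : x ∈ Sp A := by
  classical
  obtain ⟨z, h0, hz, h1⟩ := mem_US.1 hU
  apply wh_glue h x (Pi.single i ⟨z, mem_Eig.2 hz⟩)
  · intro hc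
    have := congrFun hc i
    simp only [Pi.single_eq_same] at this
    exact h0 (congrArg Subtype.val this)
  · rw [psi_apply]
    apply Finset.sum_eq_zero
    intro j _
    by_cases hj : j = i
    · subst hj; simp [h1]
    · simp [Pi.single_eq_of_ne hj]

lemma wh_h3 (h : IsWh A) (hl : 0 < l) (x : ℝ) (hc : cc A x = k)
    (hm : Module.finrank ℝ (Eig A x) = k + 1) : x = A ax ax := by
  have hN : ∀ i, x ∈ Sp (Br A i) := by
    rw [cc_eq h hl] at hc
    have : (Finset.univ.filter (fun i => x ∈ Sp (Br A i))) = Finset.univ :=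
      Finset.eq_univ_of_card _ (by rw [hc]; simp)
    intro i
    have hi := Finset.mem_univ i
    rw [← this] at hi
    exact (Finset.mem_filter.1 hi).2
  have hU : ∀ i, x ∈ US (Br A i) := by
    intro i
    by_contra hi
    have := wh_h1 h x i (hN i) hi
    omega
  have hex : ∃ y ∈ Eig A x, y ax ≠ 0 := by
    by_contra! hcon
    have := le_cc h x (Eig A x) le_rfl hcon
    omega
  obtain ⟨y, hy, hy0⟩ := hex
  rw [mem_Eig] at hy
  have hv : ∀ i, y (em i (Sum.inl ())) = 0 := by
    intro i
    obtain ⟨w, hw0, hw⟩ := (h.br i).US_leg hl x (hU i)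
    refine (h.br i).pair hl 0 x w hw hw0 (y ∘ em i) ?_
    intro m
    have e := h.row_br y i (lg 0 m)
    rw [hy, h.symm.apply] at e
    rw [show A ax (em i (lg 0 m)) = 0 from h.h0' i _, zero_mul, add_zero] at e
    exact e.symm
  have e := h.row_ax y
  rw [hy] at e
  simp only [hv, mul_zero, Finset.sum_const_zero, add_zero, Pi.smul_apply, smul_eq_mul] at e
  exact mul_right_cancel₀ hy0 e

lemma wh_gt (h : IsWh A) (hl : 0 < l) (x : ℝ) (i : Fin k) (hi : x ∈ Sp (Br A i)) :
    (∃ m ∈ Sp A, x < m) ∧ (∃ m ∈ Sp A, m < x) := by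
  by_cases hU : x ∈ US (Br A i)
  · obtain ⟨w, hw0, hw⟩ := (h.br i).US_leg hl x hU
    apply ext_gt h.symm (em i ∘ lg 0) ((em_inj i).comp (lg_inj 0)) x w hw (em i (Sum.inl ()))
    · rintro ⟨m, hm⟩
      have := em_inj i hm
      simp [lg] at this
    · have n1 : w ⟨0, hl⟩ ≠ 0 := fun hh => hw0 ((h.br i).path hl 0 x w hw hh)
      have n2 := ((h.br i).h1 0 ⟨0, hl⟩).2 rfl
      rw [Finset.sum_eq_single ⟨0, hl⟩]
      · exact mul_ne_zero n2 n1
      · intro m _ hm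
        have : Br A i (Sum.inl ()) (Sum.inr (0, m)) = 0 := by
          by_contra hc
          exact hm (Fin.ext (((h.br i).h1 0 m).1 hc))
        exact mul_eq_zero_of_left this _
      · simp
  · obtain ⟨⟨z, hz, hzn⟩, _⟩ := wh_ax h x i hi hU
    apply ext_gt h.symm (em i) (em_inj i) x z hz ax
    · rintro ⟨b, hb⟩
      rcases b with ⟨⟩ | ⟨j, m⟩ <;> simp [em] at hb
    · rw [h.ax_sum]
      exact mul_ne_zero (h.h0 i) hzn

lemma wh_h6 (h : IsWh A) (hl : 0 < l) (hk : 0 < k) :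
    ∃ x ∈ Sp A, ∃ y ∈ Sp A, x ≠ y ∧ cc A x = 0 ∧ cc A y = 0 := by
  have c0 : ∀ x, (∀ i, x ∉ Sp (Br A i)) → cc A x = 0 := by
    intro x hx
    rw [cc_eq h hl, Finset.card_eq_zero, Finset.filter_eq_empty_iff]
    intro i _; exact hx i
  obtain ⟨x0, hx0⟩ : (Sp (Br A ⟨0, hk⟩)).Nonempty := by
    rw [← Finset.card_pos, (h.br _).card_Sp hl]; omega
  obtain ⟨⟨a, ha, hxa⟩, ⟨b, hb, hbx⟩⟩ := wh_gt h hl x0 _ hx0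
  obtain ⟨M, hM, hM'⟩ := Finset.exists_max_image (Sp A) id ⟨a, ha⟩
  obtain ⟨N, hN, hN'⟩ := Finset.exists_min_image (Sp A) id ⟨a, ha⟩
  simp only [id] at hM' hN'
  refine ⟨M, hM, N, hN, ?_, c0 _ ?_, c0 _ ?_⟩
  · have := hM' a ha
    have := hN' b hb
    intro hh; linarith
  · intro i hi
    obtain ⟨⟨c, hc, hxc⟩, _⟩ := wh_gt h hl M i hi
    linarith [hM' c hc]
  · intro i hi
    obtain ⟨_, ⟨c, hc, hxc⟩⟩ := wh_gt h hl N i hi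
    linarith [hN' c hc]

lemma wh_bound (h : IsWh A) (hk : 3 ≤ k) (hl : 2 ≤ l) :
    ((k : ℚ) - 2) * ((l : ℚ) - 1) ≤
      ((k : ℚ) - 1) ^ 2 * (((Sp A).card : ℚ) - (2 * l + 3)) := by
  have hl0 : 0 < l := by omega
  refine counting k l hk (Sp A) (fun i => Sp (Br A i)) (fun i => US (Br A i)) ?_
    (fun i => (h.br i).card_Sp hl0) (fun i => (h.br i).card_US hl0)
    (fun x => Module.finrank ℝ (Eig A x)) (cc A) (A ax ax) (cc_eq h hl0) ?_
    (fun i x => wh_h1 h x i) (wh_h2 h) (fun x hx => (finrank_pos_iff A x).1 hx)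
    (wh_h3 h hl0) (wh_h4 h) (fun i x => wh_h5 h x i) (wh_h6 h hl0 (by omega))
    (fun x hx => (finrank_pos_iff A x).2 hx)
  · intro i x hx
    obtain ⟨z, h0, hz, _⟩ := mem_US.1 hx
    exact mem_Sp.2 ⟨z, h0, hz⟩
  · rw [sum_finrank h.symm]
    simp
    ring

end wh
lemma wh_adj {k l : ℕ} {A : Matrix (Vt k l) (Vt k l) ℝ} (hs : A.IsSymm)
    (hg : graphOf A = whirl k l) (u w : Vt k l) (h : u ≠ w) :
    A u w ≠ 0 ↔ (whirl k l).Adj u w := by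
  rw [← hg, graphOf, SimpleGraph.fromRel_adj, hs.apply u w]
  tauto

lemma isWh {k l : ℕ} {A : Matrix (Vt k l) (Vt k l) ℝ} (hs : A.IsSymm)
    (hg : graphOf A = whirl k l) : IsWh A := by
  have ha := wh_adj hs hg
  have hn : ∀ u w, u ≠ w → ¬ (whirl k l).Adj u w → A u w = 0 := by
    intro u w h1 h2
    by_contra hc
    exact h2 ((ha u w h1).1 hc)
  refine ⟨hs, ?_, ?_, ?_, ?_⟩
  · intro i
    rw [ha _ _ (by simp [em])]
    simp [em, whirl, genWhirl, SimpleGraph.fromRel_adj]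
  · intro i q
    apply hn _ _ (by simp [em])
    simp [em, whirl, genWhirl, SimpleGraph.fromRel_adj]
  · rintro i i' (⟨⟩ | ⟨j, m⟩) (⟨⟩ | ⟨j', m'⟩) hi
    all_goals
      apply hn _ _ (by simp [em, hi])
      simp [em, whirl, genWhirl, SimpleGraph.fromRel_adj, hi, Ne.symm hi]
  · intro i
    refine ⟨hs.submatrix _, ?_, ?_, ?_⟩
    · intro j m
      rw [submatrix_apply, ha _ _ (by simp [em])]
      simp [em, whirl, genWhirl, SimpleGraph.fromRel_adj]
    · intro j j' m m' hj
      rw [submatrix_apply]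
      apply hn _ _ (by simp [em, hj])
      simp [em, whirl, genWhirl, SimpleGraph.fromRel_adj, hj, Ne.symm hj]
    · intro j m m' hm
      rw [submatrix_apply, ha _ _ (by simp [em, hm])]
      simp [em, whirl, genWhirl, SimpleGraph.fromRel_adj, hm]

lemma edist_ax {k l : ℕ} (u : Vt k l) : (whirl k l).edist ax u ≤ ((l + 1 : ℕ) : ℕ∞) := by
  have h1 : ∀ i, (whirl k l).edist ax (em i (Sum.inl ())) ≤ 1 := by
    intro i
    apply le_of_eq
    rw [SimpleGraph.edist_eq_one_iff_adj]
    simp [em, whirl, genWhirl, SimpleGraph.fromRel_adj]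
  have h2 : ∀ (i : Fin k) (j : Fin 2) (n : ℕ) (hn : n < l),
      (whirl k l).edist ax (em i (lg j ⟨n, hn⟩)) ≤ ((n + 2 : ℕ) : ℕ∞) := by
    intro i j n
    induction n with
    | zero =>
      intro hn
      have e : (whirl k l).edist (em i (Sum.inl ())) (em i (lg j ⟨0, hn⟩)) = 1 := by
        rw [SimpleGraph.edist_eq_one_iff_adj]
        simp [em, lg, whirl, genWhirl, SimpleGraph.fromRel_adj]
      refine (SimpleGraph.edist_triangle (v := em i (Sum.inl ()))).trans ?_
      rw [e]
      calc _ ≤ (1 : ℕ∞) + 1 := by gcongr; exact h1 i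
        _ = _ := by norm_num
    | succ n ih =>
      intro hn
      have e : (whirl k l).edist (em i (lg j ⟨n, by omega⟩)) (em i (lg j ⟨n + 1, hn⟩)) = 1 := by
        rw [SimpleGraph.edist_eq_one_iff_adj]
        simp [em, lg, whirl, genWhirl, SimpleGraph.fromRel_adj]
      refine (SimpleGraph.edist_triangle (v := em i (lg j ⟨n, by omega⟩))).trans ?_
      rw [e]
      calc _ ≤ ((n + 2 : ℕ) : ℕ∞) + 1 := by gcongr; exact ih _
        _ = _ := by push_cast; ring
  rcases u with ⟨⟩ | i | ⟨⟨i, j⟩, m⟩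
  · simp
  · refine (h1 i).trans ?_
    exact_mod_cast (by omega : 1 ≤ l + 1)
  · refine (h2 i j m m.2).trans ?_
    have := m.2
    exact_mod_cast (by omega : (m : ℕ) + 2 ≤ l + 1)

def sdep {k l : ℕ} (i0 : Fin k) : Vt k l → ℤ
  | Sum.inl _ => 0
  | Sum.inr (Sum.inl i) => if i = i0 then 1 else -1
  | Sum.inr (Sum.inr q) => if q.1.1 = i0 then (q.2 : ℕ) + 2 else -((q.2 : ℕ) + 2)

lemma sdep_adj {k l : ℕ} (i0 : Fin k) (u w : Vt k l) (h : (whirl k l).Adj u w) :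
    sdep i0 u ≤ sdep i0 w + 1 := by
  rcases u with ⟨⟩ | i | ⟨⟨i, j⟩, m⟩ <;> rcases w with ⟨⟩ | i' | ⟨⟨i', j'⟩, m'⟩ <;>
    simp [whirl, genWhirl, SimpleGraph.fromRel_adj] at h <;> simp only [sdep]
  · split_ifs <;> omega
  · split_ifs <;> omega
  · obtain ⟨rfl, h⟩ := h
    rw [h]; split_ifs <;> simp
  · obtain ⟨rfl, h⟩ := h
    rw [h]; split_ifs <;> simp
  · obtain ⟨_, ⟨⟨rfl, rfl⟩, h⟩ | ⟨⟨rfl, rfl⟩, h⟩⟩ := h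
    · split_ifs <;> omega
    · split_ifs <;> omega

lemma sdep_walk {k l : ℕ} (i0 : Fin k) (u w : Vt k l) (p : (whirl k l).Walk u w) :
    sdep i0 u ≤ sdep i0 w + p.length := by
  induction p with
  | nil => simp
  | cons h p ih =>
    have := sdep_adj i0 _ _ h
    rw [SimpleGraph.Walk.length_cons]; push_cast; linarith

lemma whirl_diam (k l : ℕ) (hk : 2 ≤ k) (hl : 0 < l) : (whirl k l).diam = 2 * l + 2 := by
  have hE : (whirl k l).ediam ≤ ((2 * l + 2 : ℕ) : ℕ∞) := by
    refine (SimpleGraph.ediam_le_two_mul_eccent (ax : Vt k l)).trans ?_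
    have : (whirl k l).eccent ax ≤ ((l + 1 : ℕ) : ℕ∞) :=
      (SimpleGraph.eccent_le_iff _ _).2 edist_ax
    calc _ ≤ 2 * ((l + 1 : ℕ) : ℕ∞) := by gcongr
      _ = _ := by push_cast; ring
  have hT : (whirl k l).ediam ≠ ⊤ := ne_top_of_le_ne_top (ENat.natCast_ne_top _) hE
  apply le_antisymm
  · exact ENat.toNat_le_of_le_natCast hE
  · have : Nonempty (Vt k l) := ⟨ax⟩
    have hc := SimpleGraph.connected_of_ediam_ne_top hT
    let u : Vt k l := em ⟨0, by omega⟩ (lg 0 ⟨l - 1, by omega⟩)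
    let w : Vt k l := em ⟨1, by omega⟩ (lg 0 ⟨l - 1, by omega⟩)
    refine le_trans ?_ (SimpleGraph.dist_le_diam hT (u := u) (v := w))
    obtain ⟨p, hp⟩ := hc.exists_walk_length_eq_dist u w
    have := sdep_walk ⟨0, by omega⟩ u w p
    rw [hp] at this
    generalize (whirl k l).dist u w = dd at this ⊢
    simp [u, w, em, lg, sdep] at this
    omega

lemma nonempty_set (k l : ℕ) : ∃ A : Matrix (Vt k l) (Vt k l) ℝ,
    A.IsSymm ∧ graphOf A = whirl k l := by
  classical
  refine ⟨(whirl k l).adjMatrix ℝ, (whirl k l).isSymm_adjMatrix, ?_⟩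
  ext u w
  rw [graphOf, SimpleGraph.fromRel_adj]
  simp only [SimpleGraph.adjMatrix_apply]
  constructor
  · rintro ⟨_, h | h⟩
    · by_contra hc; simp [hc] at h
    · by_contra hc
      simp at h
      exact hc h.symm
  · intro h
    exact ⟨h.ne, Or.inl (by simp [h])⟩

end WhirlPf

/-- For the `(k,ℓ)`-whirl `W` with `k ≥ 3`, `ℓ ≥ 2` and diameter `d(W) = 2ℓ + 2`, one has
`q(W) ≥ d(W) + 1 + (k-2)(ℓ-1)/(k-1)² > d(W) + 1`. -/
theorem minDistinctEigen_whirl (k ℓ : ℕ) (hk : 3 ≤ k) (hℓ : 2 ≤ ℓ) :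
    (whirl k ℓ).diam = 2 * ℓ + 2 ∧
    (((2 * ℓ : ℚ) + 2) + 1 + ((k : ℚ) - 2) * ((ℓ : ℚ) - 1) / ((k : ℚ) - 1) ^ 2 ≤
      (minDistinctEigen (whirl k ℓ) : ℚ)) ∧
    ((2 * ℓ : ℚ) + 2) + 1 <
      ((2 * ℓ : ℚ) + 2) + 1 + ((k : ℚ) - 2) * ((ℓ : ℚ) - 1) / ((k : ℚ) - 1) ^ 2 := by
  have hk' : (3 : ℚ) ≤ k := by exact_mod_cast hk
  have hl' : (2 : ℚ) ≤ ℓ := by exact_mod_cast hℓ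
  have hpos : (0 : ℚ) < ((k : ℚ) - 1) ^ 2 := by
    have : (0 : ℚ) < (k : ℚ) - 1 := by linarith
    positivity
  refine ⟨WhirlPf.whirl_diam k ℓ (by omega) (by omega), ?_, ?_⟩
  · have hne : {q | ∃ A : Matrix (WhirlPf.Vt k ℓ) (WhirlPf.Vt k ℓ) ℝ, A.IsSymm ∧
        graphOf A = whirl k ℓ ∧ q = A.charpoly.roots.toFinset.card}.Nonempty := by
      obtain ⟨A, h1, h2⟩ := WhirlPf.nonempty_set k ℓ
      exact ⟨_, A, h1, h2, rfl⟩
    obtain ⟨A, h1, h2, h3⟩ := Nat.sInf_mem hne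
    have hb := WhirlPf.wh_bound (WhirlPf.isWh h1 h2) hk hℓ
    have h3' : minDistinctEigen (whirl k ℓ) = (WhirlPf.Sp A).card := h3
    rw [h3']
    have := (div_le_iff₀' hpos).2 hb
    linarith
  · have : (0 : ℚ) < ((k : ℚ) - 2) * ((ℓ : ℚ) - 1) / ((k : ℚ) - 1) ^ 2 :=
      div_pos (mul_pos (by linarith) (by linarith)) hpos
    linarith
end

section
/- Let H be a connected graph on m vertices containing three distinguished vertices v_1, v_2, v_3 such that for every choice {s,t,k} = {1,2,3} there is a unique shortest path in H from v_s to v_t that does not pass through v_k, and let G be the connected graph on n = 6ℓ + m vertices obtained from H by attaching to each v_i two pendant paths (legs), each with ℓ vertices (ℓ ≥ 1). Then the minimum number q(G) of distinct eigenvalues over all real symmetric matrices whose graph is G satisfies q(G) ≥ 9ℓ/4 − 2m + 15/2. -/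
open Polynomial Matrix

/-- The graph obtained from `H` by attaching, at each of the three distinguished vertices
`v 0, v 1, v 2`, two pendant paths (legs) each having `ℓ` vertices. -/
def attachSixLegs {m : ℕ} (H : SimpleGraph (Fin m)) (v : Fin 3 → Fin m) (ℓ : ℕ) :
    SimpleGraph (Fin m ⊕ Fin 3 × Fin 2 × Fin ℓ) :=
  SimpleGraph.fromRel (fun a b =>
    match a, b with
    | Sum.inl x, Sum.inl y => H.Adj x y
    | Sum.inl x, Sum.inr (i, _, r) => x = v i ∧ (r : ℕ) = 0
    | Sum.inr (i, j, r), Sum.inr (i', j', r') =>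
        i = i' ∧ j = j' ∧ (r : ℕ) + 1 = (r' : ℕ)
    | _, _ => False)

section helpers

lemma sum_finrank_eigenspace_le {V : Type*} [AddCommGroup V] [Module ℝ V]
    [FiniteDimensional ℝ V] (T : Module.End ℝ V) (s : Finset ℝ) :
    ∑ μ ∈ s, Module.finrank ℝ (Module.End.eigenspace T μ) ≤ Module.finrank ℝ V := by
  classical
  have key : ∑ μ ∈ s, Module.finrank ℝ (Module.End.eigenspace T μ) ≤
      Module.finrank ℝ (⨆ μ ∈ s, Module.End.eigenspace T μ : Submodule ℝ V) := by
    induction s using Finset.induction_on with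
    | empty => simp
    | insert a s ha ih =>
      rw [Finset.sum_insert ha, Finset.iSup_insert]
      have hd := T.eigenspaces_iSupIndep.disjoint_biSup (x := a) (y := (s : Set ℝ)) (by simpa using ha)
      have h2 := Submodule.finrank_sup_add_finrank_inf_eq (Module.End.eigenspace T a)
        (⨆ μ ∈ s, Module.End.eigenspace T μ)
      have h3 : Module.End.eigenspace T a ⊓ (⨆ μ ∈ s, Module.End.eigenspace T μ) = ⊥ := by
        simpa using hd.eq_bot
      rw [h3, finrank_bot] at h2
      omega
  exact key.trans (Submodule.finrank_le _)

lemma finrank_le_of_maps {E F W : Type*} [AddCommGroup E] [Module ℝ E] [FiniteDimensional ℝ E]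
    [AddCommGroup F] [Module ℝ F] [FiniteDimensional ℝ F]
    [AddCommGroup W] [Module ℝ W] [FiniteDimensional ℝ W]
    (K : Submodule ℝ E) (Y : Submodule ℝ W) (f : E →ₗ[ℝ] F) (g : E →ₗ[ℝ] W)
    (h1 : ∀ x ∈ K, f x = 0 → g x ∈ Y) (h2 : ∀ x ∈ K, f x = 0 → g x = 0 → x = 0) :
    Module.finrank ℝ K ≤ Module.finrank ℝ F + Module.finrank ℝ Y := by
  have e1 := LinearMap.finrank_range_add_finrank_ker (f.domRestrict K)
  have e2 : Module.finrank ℝ (LinearMap.range (f.domRestrict K)) ≤ Module.finrank ℝ F :=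
    Submodule.finrank_le _
  let φ : LinearMap.ker (f.domRestrict K) →ₗ[ℝ] Y :=
    LinearMap.codRestrict Y (g ∘ₗ K.subtype ∘ₗ (LinearMap.ker (f.domRestrict K)).subtype)
      (fun x => h1 x.1.1 x.1.2 x.2)
  have e3 : Module.finrank ℝ (LinearMap.ker (f.domRestrict K)) ≤ Module.finrank ℝ Y := by
    apply LinearMap.finrank_le_finrank_of_injective (f := φ)
    rw [← LinearMap.ker_eq_bot, LinearMap.ker_eq_bot']
    intro x hx
    have : g x.1.1 = 0 := congrArg Subtype.val hx
    have := h2 x.1.1 x.1.2 x.2 this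
    exact Subtype.ext (Subtype.ext this)
  omega

lemma card_le_sum_finrank {V : Type*} [Fintype V] [DecidableEq V] (A : Matrix V V ℝ)
    (hA : A.IsSymm) : Fintype.card V ≤ ∑ μ ∈ A.charpoly.roots.toFinset,
      Module.finrank ℝ (Module.End.eigenspace (Matrix.toLin' A) μ) := by
  classical
  have hH : A.IsHermitian := by
    rw [Matrix.IsHermitian, Matrix.conjTranspose_eq_transpose_of_trivial]; exact hA
  have h1 : ∀ i ∈ (Finset.univ : Finset V), hH.eigenvalues i ∈ A.charpoly.roots.toFinset := by
    intro i _
    rw [hH.roots_charpoly_eq_eigenvalues]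
    simp
  rw [← Finset.card_univ, Finset.card_eq_sum_card_fiberwise h1]
  apply Finset.sum_le_sum
  intro μ _
  set S : Finset V := Finset.univ.filter (fun i => hH.eigenvalues i = μ)
  let ψ : S → Module.End.eigenspace (Matrix.toLin' A) μ := fun i =>
    ⟨WithLp.ofLp (hH.eigenvectorBasis i.1), by
      have hi : hH.eigenvalues i.1 = μ := (Finset.mem_filter.mp i.2).2
      rw [Module.End.mem_eigenspace_iff, Matrix.toLin'_apply, ← hi]
      exact hH.mulVec_eigenvectorBasis i.1⟩
  have hli : LinearIndependent ℝ ψ := by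
    have a1 := (hH.eigenvectorBasis.toBasis.linearIndependent).comp (fun i : S => i.1)
      Subtype.val_injective
    have a2 := a1.map' (WithLp.linearEquiv 2 ℝ (V → ℝ)).toLinearMap (LinearEquiv.ker _)
    apply LinearIndependent.of_comp (Submodule.subtype _)
    have e : (Submodule.subtype _ ∘ ψ) = (⇑(WithLp.linearEquiv 2 ℝ (V → ℝ)).toLinearMap ∘
        ⇑hH.eigenvectorBasis.toBasis ∘ fun i : S => i.1) := by
      ext i j
      simp [ψ]
    rw [e]
    exact a2
  simpa using hli.fintype_card_le_finrank

lemma pencil {V : Type*} [AddCommGroup V] [Module ℝ V] [FiniteDimensional ℝ V]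
    (P N : Module.End ℝ V) (hP : ∀ y, P y = 0 → y = 0) (l0 : ℝ) (s : Finset ℝ) :
    ∑ μ ∈ s, Module.finrank ℝ (LinearMap.ker (P - (μ - l0) • N)) +
      Module.finrank ℝ (LinearMap.ker N) ≤ Module.finrank ℝ V := by
  classical
  have hinj : Function.Injective P := by
    rw [← LinearMap.ker_eq_bot, LinearMap.ker_eq_bot']; exact hP
  let e := LinearEquiv.ofInjectiveEndo P hinj
  have he : ∀ y, e y = P y := fun y => rfl
  let T : Module.End ℝ V := e.symm.toLinearMap ∘ₗ N
  have hT : ∀ y, P (T y) = N y := fun y => by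
    rw [← he]; simp [T]
  have hsub : ∀ μ ∈ s, Module.finrank ℝ (LinearMap.ker (P - (μ - l0) • N)) ≤
      if μ = l0 then 0 else Module.finrank ℝ (Module.End.eigenspace T (μ - l0)⁻¹) := by
    intro μ _
    split_ifs with h
    · subst h
      have : LinearMap.ker (P - (μ - μ) • N) = ⊥ := by
        rw [LinearMap.ker_eq_bot']
        intro y hy
        exact hP y (by simpa using hy)
      rw [this]; simp
    · apply Submodule.finrank_mono
      intro y hy
      have hne : μ - l0 ≠ 0 := sub_ne_zero.mpr h
      have h1 : P y = (μ - l0) • N y := by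
        simpa [sub_eq_zero] using hy
      rw [Module.End.mem_eigenspace_iff]
      apply hinj
      rw [hT, map_smul, h1, smul_smul, inv_mul_cancel₀ hne, one_smul]
  have h0 : Module.finrank ℝ (LinearMap.ker N) ≤ Module.finrank ℝ (Module.End.eigenspace T 0) := by
    apply Submodule.finrank_mono
    intro y hy
    rw [Module.End.mem_eigenspace_iff]
    apply hinj
    rw [hT]; simpa using hy
  let s' := (s.filter (fun μ => μ ≠ l0)).image (fun μ => (μ - l0)⁻¹)
  have h0s : (0 : ℝ) ∉ s' := by
    simp only [s', Finset.mem_image, Finset.mem_filter, not_exists, not_and]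
    intro x hx h
    exact inv_ne_zero (sub_ne_zero.mpr hx.2) h
  have hfin := sum_finrank_eigenspace_le T (insert 0 s')
  rw [Finset.sum_insert h0s, Finset.sum_image (by
    intro x _ y _ h
    simpa using h)] at hfin
  have := Finset.sum_le_sum hsub
  rw [Finset.sum_ite, Finset.sum_const_zero, zero_add] at this
  simp only [ne_eq] at hfin
  omega

attribute [local instance] Matrix.linftyOpNormedAddCommGroup in
lemma reg {m : ℕ} (B : Matrix (Fin m) (Fin m) ℝ) (s t : Fin m) (d : ℕ)
    (h0 : ∀ j < d, (B ^ j) s t = 0) (hd : (B ^ d) s t ≠ 0) :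
    ∃ l0 : ℝ, ∀ (y : Fin m → ℝ) (c : ℝ), y s = 0 → B *ᵥ y = l0 • y - c • Pi.single t 1 →
      y = 0 := by
  set α := (B ^ d) s t with hα
  have hα' : 0 < |α| := abs_pos.mpr hd
  refine ⟨‖B‖ + ‖B ^ (d+1)‖ / |α| + 1, ?_⟩
  set l0 := ‖B‖ + ‖B ^ (d+1)‖ / |α| + 1 with hl0
  intro y c hy hB
  have step : ∀ j, ((B ^ (j+1)) *ᵥ y) s = l0 * ((B ^ j) *ᵥ y) s - c * (B ^ j) s t := by
    intro j
    rw [pow_succ, ← Matrix.mulVec_mulVec, hB, Matrix.mulVec_sub, Matrix.mulVec_smul,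
      Matrix.mulVec_smul]
    simp
  have hz : ∀ j ≤ d, ((B ^ j) *ᵥ y) s = 0 := by
    intro j
    induction j with
    | zero => intro _; simpa using hy
    | succ j ih =>
      intro hj
      rw [step, ih (by omega), h0 j (by omega)]; simp
  have hlast : ((B ^ (d+1)) *ᵥ y) s = - (c * α) := by
    rw [step, hz d le_rfl]; ring
  have n1 : |c| * |α| ≤ ‖B ^ (d+1)‖ * ‖y‖ := by
    rw [← abs_mul, ← abs_neg, ← hlast]
    exact (norm_le_pi_norm ((B ^ (d+1)) *ᵥ y) s).trans (Matrix.linfty_opNorm_mulVec _ _)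
  have hl0pos : 0 ≤ l0 := by positivity
  have n2 : l0 * ‖y‖ ≤ ‖B‖ * ‖y‖ + |c| := by
    have e : l0 • y = B *ᵥ y + c • (Pi.single t 1 : Fin m → ℝ) := by rw [hB]; simp
    have := norm_add_le (B *ᵥ y) (c • (Pi.single t 1 : Fin m → ℝ))
    rw [← e, norm_smul, norm_smul, Real.norm_eq_abs, abs_of_nonneg hl0pos, Real.norm_eq_abs] at this
    have h1 : ‖(Pi.single t 1 : Fin m → ℝ)‖ ≤ 1 := by
      rw [pi_norm_le_iff_of_nonneg zero_le_one]
      intro i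
      by_cases h : i = t
      · subst h; simp
      · simp [h]
    have h2 := Matrix.linfty_opNorm_mulVec B y
    nlinarith [abs_nonneg c]
  have n3 : (l0 - ‖B‖) * |α| = ‖B ^ (d+1)‖ + |α| := by
    rw [hl0]; field_simp; ring
  have n4 : (l0 - ‖B‖) * ‖y‖ ≤ |c| := by linarith
  have n5 : (‖B ^ (d+1)‖ + |α|) * ‖y‖ ≤ ‖B ^ (d+1)‖ * ‖y‖ := by
    rw [← n3]
    calc _ = ((l0 - ‖B‖) * ‖y‖) * |α| := by ring
      _ ≤ |c| * |α| := by gcongr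
      _ ≤ _ := n1
  have n6 : |α| * ‖y‖ ≤ 0 := by linarith
  have : ‖y‖ = 0 := by
    have := norm_nonneg y
    nlinarith
  exact norm_eq_zero.mp this

attribute [local instance] Matrix.linftyOpNormedAddCommGroup in
lemma reg0 {m : ℕ} (B : Matrix (Fin m) (Fin m) ℝ) :
    ∃ l0 : ℝ, ∀ (y : Fin m → ℝ), (∀ h, y h = 0 ∨ (B *ᵥ y) h = l0 * y h) → y = 0 := by
  refine ⟨‖B‖ + 1, ?_⟩
  intro y hy
  have n1 : ‖(‖B‖ + 1) • y‖ ≤ ‖B‖ * ‖y‖ := by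
    rw [pi_norm_le_iff_of_nonneg (by positivity)]
    intro h
    rcases hy h with h1 | h1
    · simp [h1]; positivity
    · simp only [Pi.smul_apply, smul_eq_mul]
      rw [← h1]
      exact (norm_le_pi_norm (B *ᵥ y) h).trans (Matrix.linfty_opNorm_mulVec _ _)
  rw [norm_smul, Real.norm_eq_abs, abs_of_nonneg (by positivity)] at n1
  have := norm_nonneg y
  exact norm_eq_zero.mp (by nlinarith)

lemma walk_of_pow {m : ℕ} (H : SimpleGraph (Fin m)) (u : Fin m) (B : Matrix (Fin m) (Fin m) ℝ)
    (hB : ∀ x y, x ≠ y → B x y ≠ 0 → H.Adj x y ∧ x ≠ u ∧ y ≠ u) (b : Fin m) (hb : b ≠ u) (k : ℕ) :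
    ∀ c, (B ^ k) c b ≠ 0 → ∃ w : H.Walk c b, u ∉ w.support ∧ w.length ≤ k := by
  induction k with
  | zero =>
    intro c hc
    have : c = b := by
      by_contra h
      simp [h] at hc
    subst this
    exact ⟨.nil, by simpa using hb.symm, by simp⟩
  | succ k ih =>
    intro c hc
    rw [pow_succ', Matrix.mul_apply] at hc
    obtain ⟨e, -, he⟩ := Finset.exists_ne_zero_of_sum_ne_zero hc
    obtain ⟨w, hw, hl⟩ := ih e (right_ne_zero_of_mul he)
    by_cases hce : c = e
    · subst hce
      exact ⟨w, hw, by omega⟩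
    · obtain ⟨h1, h2, h3⟩ := hB c e hce (left_ne_zero_of_mul he)
      refine ⟨.cons h1 w, ?_, by simpa using hl⟩
      simp [hw, h2.symm]

lemma pow_ne_of_unique {m : ℕ} (H : SimpleGraph (Fin m)) (u : Fin m)
    (B : Matrix (Fin m) (Fin m) ℝ)
    (hB : ∀ x y, x ≠ y → (B x y ≠ 0 ↔ H.Adj x y ∧ x ≠ u ∧ y ≠ u)) (a b : Fin m)
    (w : H.Walk a b) (hw : u ∉ w.support)
    (hmin : ∀ w' : H.Walk a b, u ∉ w'.support → w.length ≤ w'.length)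
    (hun : ∀ w' : H.Walk a b, u ∉ w'.support → w'.length = w.length → w' = w) :
    (B ^ w.length) a b ≠ 0 := by
  induction w with
  | nil => simp
  | @cons a c b h w ih =>
    have hau : a ≠ u := by rintro rfl; simp at hw
    have hwu : u ∉ w.support := by intro h; simp [h] at hw
    have hbu : b ≠ u := by rintro rfl; exact hwu w.end_mem_support
    have hcu : c ≠ u := by rintro rfl; exact hwu w.start_mem_support
    have ih' := ih hwu
      (fun w' hw' => by
        have := hmin (.cons h w') (by simp [hw', hau.symm])
        simpa using this)
      (fun w' hw' hl => by
        have := hun (.cons h w') (by simp [hw', hau.symm]) (by simp [hl])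
        simpa using this)
    rw [SimpleGraph.Walk.length_cons, pow_succ', Matrix.mul_apply, Finset.sum_eq_single c]
    · exact mul_ne_zero ((hB a c h.ne).mpr ⟨h, hau, hcu⟩) ih'
    · intro e _ hec
      by_contra hne
      obtain ⟨w', hw', hl'⟩ := walk_of_pow H u B (fun x y hxy hne => (hB x y hxy).mp hne) b hbu
        w.length e (right_ne_zero_of_mul hne)
      by_cases hae : a = e
      · subst hae
        have := hmin w' hw'
        simp at this
        omega
      · have hadj := (hB a e hae).mp (left_ne_zero_of_mul hne)
        have hs : u ∉ (SimpleGraph.Walk.cons hadj.1 w').support := by simp [hw', hau.symm]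
        have l1 := hmin (.cons hadj.1 w') hs
        simp at l1
        have := hun (.cons hadj.1 w') hs (by simp; omega)
        simp at this
        exact hec this.1
    · simp

noncomputable def offN {m : ℕ} (v : Fin 3 → Fin m) : Module.End ℝ (Fin m → ℝ) :=
  open Classical in
  LinearMap.pi (fun h => if h ∈ Set.range v then 0 else LinearMap.proj h)

lemma finrank_ker_offN {m : ℕ} (v : Fin 3 → Fin m) (hv : Function.Injective v) :
    3 ≤ Module.finrank ℝ (LinearMap.ker (offN v)) := by
  let ψ : Fin 3 → LinearMap.ker (offN v) := fun i => ⟨Pi.single (v i) 1, by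
    rw [LinearMap.mem_ker]
    ext h
    simp only [offN, LinearMap.pi_apply]
    split_ifs with hh
    · simp
    · have : h ≠ v i := by rintro rfl; exact hh ⟨i, rfl⟩
      simp [this]⟩
  have hli : LinearIndependent ℝ ψ := by
    have a1 := (Pi.basisFun ℝ (Fin m)).linearIndependent.comp v hv
    apply LinearIndependent.of_comp (Submodule.subtype _)
    have e : (Submodule.subtype _ ∘ ψ) = ⇑(Pi.basisFun ℝ (Fin m)) ∘ v := by
      ext i j
      simp [ψ]
    rw [e]
    exact a1
  simpa using hli.fintype_card_le_finrank

lemma exists_Y {m : ℕ} (v : Fin 3 → Fin m) (hv : Function.Injective v)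
    (P : Module.End ℝ (Fin m → ℝ)) (hP : ∀ y, P y = 0 → y = 0) (l0 : ℝ) :
    ∃ Y : ℝ → Submodule ℝ (Fin m → ℝ), (∀ l y, P y = (l - l0) • offN v y → y ∈ Y l) ∧
      ∀ s : Finset ℝ, ∑ l ∈ s, Module.finrank ℝ (Y l) + 3 ≤ m := by
  refine ⟨fun l => LinearMap.ker (P - (l - l0) • offN v), ?_, ?_⟩
  · intro l y h
    simp [h]
  · intro s
    have h1 := pencil P (offN v) hP l0 s
    have h2 := finrank_ker_offN v hv
    simp only [Module.finrank_fin_fun] at h1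
    exact (Nat.add_le_add_left h2 _).trans h1

lemma exists_Y0 {m : ℕ} (v : Fin 3 → Fin m) (hv : Function.Injective v)
    (M : Matrix (Fin m) (Fin m) ℝ) :
    ∃ Y : ℝ → Submodule ℝ (Fin m → ℝ), (∀ l y, (∀ i, y (v i) = 0) →
        (∀ h, (∀ i, h ≠ v i) → (M *ᵥ y) h = l * y h) → y ∈ Y l) ∧
      ∀ s : Finset ℝ, ∑ l ∈ s, Module.finrank ℝ (Y l) + 3 ≤ m := by
  classical
  obtain ⟨l0, hl0⟩ := reg0 M
  let P : Module.End ℝ (Fin m → ℝ) := LinearMap.pi (fun h => if h ∈ Set.range v then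
    LinearMap.proj h else LinearMap.proj h ∘ₗ Matrix.toLin' M - l0 • LinearMap.proj h)
  have hPin : ∀ y h, h ∈ Set.range v → P y h = y h := by
    intro y h hh
    simp only [P, LinearMap.pi_apply, if_pos hh, LinearMap.proj_apply]
  have hPout : ∀ y h, h ∉ Set.range v → P y h = (M *ᵥ y) h - l0 * y h := by
    intro y h hh
    simp only [P, LinearMap.pi_apply, if_neg hh]
    simp
  obtain ⟨Y, h1, h2⟩ := exists_Y v hv P (by
    intro y hy
    apply hl0
    intro h
    have := congrFun hy h
    by_cases hh : h ∈ Set.range v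
    · rw [hPin y h hh] at this; exact Or.inl this
    · rw [hPout y h hh] at this
      exact Or.inr (sub_eq_zero.mp this)) l0
  refine ⟨Y, ?_, h2⟩
  intro l y hy0 hy
  apply h1
  ext h
  by_cases hh : h ∈ Set.range v
  · rw [hPin y h hh]
    obtain ⟨i, rfl⟩ := hh
    simp [offN, hy0]
  · rw [hPout y h hh, hy h (fun i hi => hh ⟨i, hi.symm⟩)]
    simp only [offN, Pi.smul_apply, LinearMap.pi_apply, if_neg hh, LinearMap.proj_apply,
      smul_eq_mul]
    ring

lemma exists_Yk {m : ℕ} (H : SimpleGraph (Fin m)) (v : Fin 3 → Fin m)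
    (hv : Function.Injective v) (M : Matrix (Fin m) (Fin m) ℝ)
    (hM : ∀ x y, x ≠ y → (M x y ≠ 0 ↔ H.Adj x y)) (s t k : Fin 3)
    (hst : s ≠ t) (htk : t ≠ k) (hsk : s ≠ k)
    (huniq : ∃! w : H.Walk (v s) (v t), w.IsPath ∧ v k ∉ w.support ∧
        ∀ w' : H.Walk (v s) (v t), w'.IsPath → v k ∉ w'.support →
          w.length ≤ w'.length) :
    ∃ Y : ℝ → Submodule ℝ (Fin m → ℝ), (∀ l y, y (v k) = 0 → y (v s) = 0 →
        (∀ h, h ≠ v k → h ≠ v t → (M *ᵥ y) h = l * y h) → y ∈ Y l) ∧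
      ∀ σ : Finset ℝ, ∑ l ∈ σ, Module.finrank ℝ (Y l) + 3 ≤ m := by
  classical
  have vst : v s ≠ v t := fun h => hst (hv h)
  have vtk : v t ≠ v k := fun h => htk (hv h)
  have vsk : v s ≠ v k := fun h => hsk (hv h)
  let B : Matrix (Fin m) (Fin m) ℝ :=
    Matrix.of fun x y => if x = v k ∨ y = v k then 0 else M x y
  have hB : ∀ x y, x ≠ y → (B x y ≠ 0 ↔ H.Adj x y ∧ x ≠ v k ∧ y ≠ v k) := by
    intro x y hxy
    simp only [B, Matrix.of_apply]
    rw [← hM x y hxy]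
    split_ifs with h <;> tauto
  obtain ⟨w, ⟨hwp, hwk, hwmin⟩, hwun⟩ := huniq
  have hmin : ∀ w' : H.Walk (v s) (v t), v k ∉ w'.support → w.length ≤ w'.length := by
    intro w' hw'
    exact (hwmin w'.bypass w'.bypass_isPath
      (fun h => hw' (w'.support_bypass_subset_support h))).trans w'.length_bypass_le_length
  have hun : ∀ w' : H.Walk (v s) (v t), v k ∉ w'.support → w'.length = w.length → w' = w := by
    intro w' hw' hl
    have hb : w'.bypass = w' := by
      apply SimpleGraph.Walk.bypass_eq_self_of_length_le_length_bypass
      rw [hl]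
      exact hwmin w'.bypass w'.bypass_isPath
        (fun h => hw' (w'.support_bypass_subset_support h))
    apply hwun
    refine ⟨hb ▸ w'.bypass_isPath, hw', ?_⟩
    intro w'' a b
    rw [hl]; exact hwmin w'' a b
  obtain ⟨l0, hl0⟩ := reg B (v s) (v t) w.length (by
    intro j hj
    by_contra hne
    obtain ⟨w', a, b⟩ := walk_of_pow H (v k) B (fun x y hxy hne => (hB x y hxy).mp hne) (v t) vtk
      j (v s) hne
    have := hmin w' a
    omega) (pow_ne_of_unique H (v k) B hB _ _ w hwk hmin hun)
  let P : Module.End ℝ (Fin m → ℝ) := LinearMap.pi (fun h => if h = v k then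
    LinearMap.proj (v k) else if h = v t then LinearMap.proj (v s) else
      LinearMap.proj h ∘ₗ Matrix.toLin' M - l0 • LinearMap.proj h)
  have hPk : ∀ y, P y (v k) = y (v k) := by
    intro y
    simp [P, LinearMap.pi_apply]
  have hPt : ∀ y, P y (v t) = y (v s) := by
    intro y
    simp [P, LinearMap.pi_apply, vtk]
  have hPout : ∀ y h, h ≠ v k → h ≠ v t → P y h = (M *ᵥ y) h - l0 * y h := by
    intro y h h1 h2
    simp only [P, LinearMap.pi_apply, if_neg h1, if_neg h2]
    simp
  obtain ⟨Y, h1, h2⟩ := exists_Y v hv P (by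
    intro y hy
    have yk : y (v k) = 0 := by rw [← hPk y, hy]; rfl
    have ys : y (v s) = 0 := by rw [← hPt y, hy]; rfl
    apply hl0 y (l0 * y (v t) - (B *ᵥ y) (v t)) ys
    ext h
    by_cases hk : h = v k
    · subst hk
      have : (B *ᵥ y) (v k) = 0 := by
        simp [Matrix.mulVec, dotProduct, B]
      rw [this]
      simp [yk, vtk.symm]
    by_cases ht : h = v t
    · subst ht
      simp
    have h3 : (B *ᵥ y) h = (M *ᵥ y) h := by
      simp only [Matrix.mulVec, dotProduct]
      apply Finset.sum_congr rfl
      intro x _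
      by_cases hx : x = v k
      · subst hx; simp [yk]
      · simp [B, hk, hx]
    have h4 := hPout y h hk ht
    rw [hy] at h4
    rw [h3]
    simp only [Pi.zero_apply] at h4
    simp [ht]
    linarith) l0
  refine ⟨Y, ?_, h2⟩
  intro l y hyk hys hy
  apply h1
  ext h
  by_cases hk : h = v k
  · subst hk
    rw [hPk]
    simp [offN, hyk]
  by_cases ht : h = v t
  · subst ht
    rw [hPt]
    simp [offN, hys]
  rw [hPout y h hk ht, hy h hk ht]
  by_cases hh : h ∈ Set.range v
  · obtain ⟨i, rfl⟩ := hh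
    have : i = s := by
      have : i ≠ k := fun h => hk (by rw [h])
      have : i ≠ t := fun h => ht (by rw [h])
      omega
    subst this
    simp [offN, hys]
  · simp only [offN, Pi.smul_apply, LinearMap.pi_apply, if_neg hh, LinearMap.proj_apply,
      smul_eq_mul]
    ring

lemma force {V : Type*} [Fintype V] (A : Matrix V V ℝ) (l : ℝ) (x : V → ℝ)
    (hx : A *ᵥ x = l • x) (a c : V) (ha : x a = 0) (hc : A a c ≠ 0)
    (hb : ∀ b, b ≠ a → b ≠ c → A a b ≠ 0 → x b = 0) : x c = 0 := by
  have h := congrFun hx a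
  simp only [Matrix.mulVec, dotProduct, Pi.smul_apply, ha, smul_zero] at h
  rw [Finset.sum_eq_single c] at h
  · exact (mul_eq_zero.mp h).resolve_left hc
  · intro b _ hbc
    by_cases hba : b = a
    · subst hba; simp [ha]
    by_cases hz : A a b = 0
    · simp [hz]
    · simp [hb b hba hbc hz]
  · simp

/-- Explicit nonzero pattern of a matrix of the graph. -/
structure Pat {m ℓ : ℕ} (H : SimpleGraph (Fin m)) (v : Fin 3 → Fin m)
    (A : Matrix (Fin m ⊕ Fin 3 × Fin 2 × Fin ℓ) (Fin m ⊕ Fin 3 × Fin 2 × Fin ℓ) ℝ) : Prop where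
  hh : ∀ x y, x ≠ y → (A (.inl x) (.inl y) ≠ 0 ↔ H.Adj x y)
  hl : ∀ x i j r, A (.inl x) (.inr (i, j, r)) ≠ 0 ↔ x = v i ∧ (r : ℕ) = 0
  lh : ∀ x i j r, A (.inr (i, j, r)) (.inl x) ≠ 0 ↔ x = v i ∧ (r : ℕ) = 0
  ll : ∀ i j r i' j' r', (i, j, r) ≠ (i', j', r') →
    (A (.inr (i, j, r)) (.inr (i', j', r')) ≠ 0 ↔
      i = i' ∧ j = j' ∧ ((r : ℕ) + 1 = r' ∨ (r' : ℕ) + 1 = r))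

lemma pat_of {m ℓ : ℕ} (H : SimpleGraph (Fin m)) (v : Fin 3 → Fin m)
    (A : Matrix (Fin m ⊕ Fin 3 × Fin 2 × Fin ℓ) (Fin m ⊕ Fin 3 × Fin 2 × Fin ℓ) ℝ)
    (hA : A.IsSymm) (hG : graphOf A = attachSixLegs H v ℓ) : Pat H v A := by
  have key : ∀ a b, a ≠ b → (A a b ≠ 0 ↔ (attachSixLegs H v ℓ).Adj a b) := by
    intro a b hab
    rw [← hG]
    simp only [graphOf, SimpleGraph.fromRel_adj]
    rw [hA.apply a b]
    tauto
  constructor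
  · intro x y hxy
    rw [key _ _ (by simpa using hxy)]
    simp only [attachSixLegs, SimpleGraph.fromRel_adj]
    constructor
    · rintro ⟨-, h | h⟩
      · exact h
      · exact h.symm
    · intro h
      exact ⟨by simpa using hxy, Or.inl h⟩
  · intro x i j r
    rw [key _ _ (by simp)]
    simp [attachSixLegs, SimpleGraph.fromRel_adj]
  · intro x i j r
    rw [key _ _ (by simp)]
    simp [attachSixLegs, SimpleGraph.fromRel_adj]
  · intro i j r i' j' r' hne
    rw [key _ _ (by simpa using hne)]
    simp only [attachSixLegs, SimpleGraph.fromRel_adj]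
    constructor
    · rintro ⟨-, ⟨a, b, c⟩ | ⟨a, b, c⟩⟩
      · exact ⟨a, b, Or.inl c⟩
      · exact ⟨a.symm, b.symm, Or.inr c⟩
    · rintro ⟨a, b, c | c⟩
      · exact ⟨by simpa using hne, Or.inl ⟨a, b, c⟩⟩
      · exact ⟨by simpa using hne, Or.inr ⟨a.symm, b.symm, c⟩⟩

section
variable {m ℓ : ℕ} {H : SimpleGraph (Fin m)} {v : Fin 3 → Fin m}
    {A : Matrix (Fin m ⊕ Fin 3 × Fin 2 × Fin ℓ) (Fin m ⊕ Fin 3 × Fin 2 × Fin ℓ) ℝ}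
    {l : ℝ} {x : Fin m ⊕ Fin 3 × Fin 2 × Fin ℓ → ℝ}

lemma leg_back (hP : Pat H v A) (hx : A *ᵥ x = l • x) (i : Fin 3) (j : Fin 2) (hℓ : 1 ≤ ℓ)
    (he : x (.inr (i, j, ⟨ℓ - 1, by omega⟩)) = 0) :
    (∀ r, x (.inr (i, j, r)) = 0) ∧ x (.inl (v i)) = 0 := by
  have h1 : ∀ n : ℕ, ∀ r : Fin ℓ, (r : ℕ) + n + 1 = ℓ → x (.inr (i, j, r)) = 0 := by
    intro n
    induction n using Nat.strong_induction_on with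
    | _ n ih =>
      intro r hr
      rcases n with _ | n
      · have : r = ⟨ℓ - 1, by omega⟩ := Fin.ext (by simp; omega)
        rw [this]; exact he
      · apply force A l x hx (.inr (i, j, ⟨r + 1, by omega⟩)) _
          (ih n (by omega) _ (by simp; omega))
        · rw [hP.ll _ _ _ _ _ _ (by simp [Fin.ext_iff])]
          simp
        · rintro (b | ⟨i', j', r'⟩) hb hc hne
          · rw [hP.lh] at hne
            simp at hne
          · rw [hP.ll _ _ _ _ _ _ (by rintro h; exact hb (by rw [h]))] at hne
            obtain ⟨rfl, rfl, h | h⟩ := hne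
            · simp at h
              exact ih (n - 1) (by omega) _ (by omega)
            · exfalso; apply hc
              simp at h
              rw [Fin.ext h]
  have h2 : ∀ r, x (.inr (i, j, r)) = 0 := fun r => h1 (ℓ - 1 - r) r (by omega)
  refine ⟨h2, ?_⟩
  apply force A l x hx (.inr (i, j, ⟨0, by omega⟩)) _ (h2 _)
  · rw [hP.lh]; simp
  · rintro (b | ⟨i', j', r'⟩) hb hc hne
    · rw [hP.lh] at hne
      exact absurd (by rw [hne.1]) hc
    · rw [hP.ll _ _ _ _ _ _ (by rintro h; exact hb (by rw [h]))] at hne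
      obtain ⟨rfl, rfl, h⟩ := hne
      exact h2 _

lemma leg_fwd (hP : Pat H v A) (hx : A *ᵥ x = l • x) (i : Fin 3) (j : Fin 2) (hℓ : 1 ≤ ℓ)
    (hv0 : x (.inl (v i)) = 0) (h0 : x (.inr (i, j, ⟨0, by omega⟩)) = 0) :
    ∀ r, x (.inr (i, j, r)) = 0 := by
  have h1 : ∀ n : ℕ, ∀ hn : n < ℓ, x (.inr (i, j, ⟨n, hn⟩)) = 0 := by
    intro n
    induction n using Nat.strong_induction_on with
    | _ n ih =>
      intro hn
      rcases n with _ | n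
      · exact h0
      · apply force A l x hx (.inr (i, j, ⟨n, by omega⟩)) _ (ih n (by omega) _)
        · rw [hP.ll _ _ _ _ _ _ (by simp)]
          simp
        · rintro (b | ⟨i', j', r'⟩) hb hc hne
          · rw [hP.lh] at hne
            rw [hne.1]; exact hv0
          · rw [hP.ll _ _ _ _ _ _ (by rintro h; exact hb (by rw [h]))] at hne
            obtain ⟨rfl, rfl, h | h⟩ := hne
            · exfalso; apply hc
              simp at h
              rw [show r' = ⟨n + 1, hn⟩ from Fin.ext h.symm]
            · simp at h
              exact ih r' (by omega) r'.2
  exact fun r => h1 r r.2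

/-- Fill in a leg when all `H`-vertices and the other leg at `v i` vanish. -/
lemma leg_other (hP : Pat H v A) (hv : Function.Injective v) (hx : A *ᵥ x = l • x)
    (i : Fin 3) (j j' : Fin 2) (hj : j ≠ j') (hℓ : 1 ≤ ℓ)
    (hH : ∀ h, x (.inl h) = 0) (h0 : ∀ r, x (.inr (i, j, r)) = 0) :
    ∀ r, x (.inr (i, j', r)) = 0 := by
  apply leg_fwd hP hx i j' hℓ (hH _)
  apply force A l x hx (.inl (v i)) _ (hH _)
  · rw [hP.hl]; simp
  · rintro (b | ⟨i', j'', r'⟩) hb hc hne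
    · exact hH b
    · rw [hP.hl] at hne
      obtain ⟨h1, h2⟩ := hne
      have := hv h1
      subst this
      have : j'' = j := by
        have : j'' ≠ j' := by
          rintro rfl
          apply hc
          rw [show r' = ⟨0, by omega⟩ from Fin.ext h2]
        omega
      subst this
      exact h0 _

/-- The matrix of a leg. -/
def legM (A : Matrix (Fin m ⊕ Fin 3 × Fin 2 × Fin ℓ) (Fin m ⊕ Fin 3 × Fin 2 × Fin ℓ) ℝ)
    (i : Fin 3) (j : Fin 2) : Matrix (Fin ℓ) (Fin ℓ) ℝ :=
  A.submatrix (fun r => .inr (i, j, r)) (fun r => .inr (i, j, r))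

lemma leg_nonsing (hP : Pat H v A) (hx : A *ᵥ x = l • x) (i : Fin 3) (j : Fin 2)
    (hv0 : x (.inl (v i)) = 0)
    (hns : Module.End.eigenspace (Matrix.toLin' (legM A i j)) l = ⊥) :
    ∀ r, x (.inr (i, j, r)) = 0 := by
  have hmem : (fun r => x (.inr (i, j, r))) ∈
      Module.End.eigenspace (Matrix.toLin' (legM A i j)) l := by
    rw [Module.End.mem_eigenspace_iff, Matrix.toLin'_apply]
    ext r
    have h := congrFun hx (.inr (i, j, r))
    simp only [Pi.smul_apply] at h ⊢
    rw [← h]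
    simp only [Matrix.mulVec, dotProduct]
    apply Fintype.sum_of_injective (fun r => (.inr (i, j, r) : Fin m ⊕ Fin 3 × Fin 2 × Fin ℓ))
    · intro a b hab
      simpa using hab
    · rintro (b | ⟨i', j', r'⟩) hb
      · by_cases hz : A (.inr (i, j, r)) (.inl b) = 0
        · simp [hz]
        · rw [← ne_eq, hP.lh] at hz
          rw [hz.1, hv0, mul_zero]
      · by_cases hz : A (.inr (i, j, r)) (.inr (i', j', r')) = 0
        · simp [hz]
        · rw [← ne_eq, hP.ll _ _ _ _ _ _ (by rintro h; apply hb; simp at h; simp [h])] at hz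
          obtain ⟨rfl, rfl, -⟩ := hz
          exact absurd ⟨r', rfl⟩ hb
    · intro r'
      rfl
  rw [hns] at hmem
  intro r
  exact congrFun hmem r

lemma row_H (hx : A *ᵥ x = l • x) (h : Fin m)
    (hz : ∀ p, A (.inl h) (.inr p) * x (.inr p) = 0) :
    ((A.submatrix Sum.inl Sum.inl) *ᵥ (fun g => x (.inl g))) h = l * x (.inl h) := by
  have e := congrFun hx (.inl h)
  simp only [Pi.smul_apply, smul_eq_mul] at e
  rw [← e]
  simp only [Matrix.mulVec, dotProduct, Fintype.sum_sum_type, Matrix.submatrix_apply]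
  rw [Finset.sum_eq_zero (fun p _ => hz p), add_zero]

lemma mult_le_three (hP : Pat H v A) (hv : Function.Injective v) (hℓ : 1 ≤ ℓ)
    (Y : Submodule ℝ (Fin m → ℝ)) (hY : ∀ y : Fin m → ℝ, (∀ i, y (v i) = 0) →
        (∀ h, (∀ i, h ≠ v i) → ((A.submatrix Sum.inl Sum.inl) *ᵥ y) h = l * y h) → y ∈ Y) :
    Module.finrank ℝ (Module.End.eigenspace (Matrix.toLin' A) l) ≤ 3 + Module.finrank ℝ Y := by
  have := finrank_le_of_maps (Module.End.eigenspace (Matrix.toLin' A) l) Y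
    (F := Fin 3 → ℝ)
    (LinearMap.pi (fun i : Fin 3 =>
      LinearMap.proj (Sum.inr (i, (0 : Fin 2), (⟨ℓ - 1, by omega⟩ : Fin ℓ)))))
    (LinearMap.pi (fun g => LinearMap.proj (Sum.inl g))) ?_ ?_
  · simpa using this
  · intro x hx hf
    rw [Module.End.mem_eigenspace_iff, Matrix.toLin'_apply] at hx
    have hb := fun i => leg_back hP hx i 0 hℓ (congrFun hf i)
    apply hY
    · intro i; exact (hb i).2
    · intro h hh
      apply row_H hx
      rintro ⟨i, j, r⟩
      by_cases hz : A (.inl h) (.inr (i, j, r)) = 0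
      · simp [hz]
      · rw [← ne_eq, hP.hl] at hz
        exact absurd hz.1 (hh i)
  · intro x hx hf hg
    rw [Module.End.mem_eigenspace_iff, Matrix.toLin'_apply] at hx
    have hb := fun i => leg_back hP hx i 0 hℓ (congrFun hf i)
    have hH : ∀ h, x (.inl h) = 0 := fun h => congrFun hg h
    have h1 := fun i => leg_other hP hv hx i 0 1 (by decide) hℓ hH (hb i).1
    ext (h | ⟨i, j, r⟩)
    · exact hH h
    · fin_cases j
      · exact (hb i).1 r
      · exact h1 i r

lemma mult_le_two (hP : Pat H v A) (hv : Function.Injective v) (hℓ : 1 ≤ ℓ) (s t k : Fin 3)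
    (hst : s ≠ t) (htk : t ≠ k) (hsk : s ≠ k)
    (Y : Submodule ℝ (Fin m → ℝ)) (hY : ∀ y : Fin m → ℝ, y (v k) = 0 → y (v s) = 0 →
        (∀ h, h ≠ v k → h ≠ v t → ((A.submatrix Sum.inl Sum.inl) *ᵥ y) h = l * y h) → y ∈ Y)
    (hs : ∃ j, Module.End.eigenspace (Matrix.toLin' (legM A s j)) l = ⊥)
    (ht : ∃ j, Module.End.eigenspace (Matrix.toLin' (legM A t j)) l = ⊥) :
    Module.finrank ℝ (Module.End.eigenspace (Matrix.toLin' A) l) ≤ 2 + Module.finrank ℝ Y := by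
  obtain ⟨js, hs⟩ := hs
  obtain ⟨jt, ht⟩ := ht
  have := finrank_le_of_maps (Module.End.eigenspace (Matrix.toLin' A) l) Y
    (F := Fin 2 → ℝ)
    (LinearMap.pi ![LinearMap.proj (Sum.inr (k, 0, ⟨ℓ - 1, by omega⟩)),
      LinearMap.proj (Sum.inr (s, js + 1, ⟨ℓ - 1, by omega⟩))])
    (LinearMap.pi (fun g => LinearMap.proj (Sum.inl g))) ?_ ?_
  · simpa using this
  · intro x hx hf
    rw [Module.End.mem_eigenspace_iff, Matrix.toLin'_apply] at hx
    have hk := leg_back hP hx k 0 hℓ (congrFun hf 0)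
    have hs1 := leg_back hP hx s (js + 1) hℓ (congrFun hf 1)
    have hs2 := leg_nonsing hP hx s js hs1.2 hs
    have hs3 : ∀ j r, x (.inr (s, j, r)) = 0 := by
      intro j r
      have : j = js ∨ j = js + 1 := by omega
      rcases this with rfl | rfl
      · exact hs2 r
      · exact hs1.1 r
    apply hY _ hk.2 hs1.2
    intro h h1 h2
    apply row_H hx
    rintro ⟨i, j, r⟩
    by_cases hz : A (.inl h) (.inr (i, j, r)) = 0
    · simp [hz]
    · rw [← ne_eq, hP.hl] at hz
      have : i = s := by
        have : i ≠ k := by rintro rfl; exact h1 hz.1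
        have : i ≠ t := by rintro rfl; exact h2 hz.1
        omega
      subst this
      rw [hs3, mul_zero]
  · intro x hx hf hg
    rw [Module.End.mem_eigenspace_iff, Matrix.toLin'_apply] at hx
    have hk := leg_back hP hx k 0 hℓ (congrFun hf 0)
    have hs1 := leg_back hP hx s (js + 1) hℓ (congrFun hf 1)
    have hH : ∀ h, x (.inl h) = 0 := fun h => congrFun hg h
    have ht1 := leg_nonsing hP hx t jt (hH _) ht
    have all : ∀ i, ∃ j, ∀ r, x (.inr (i, j, r)) = 0 := by
      intro i
      have : i = s ∨ i = t ∨ i = k := by omega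
      rcases this with rfl | rfl | rfl
      · exact ⟨_, hs1.1⟩
      · exact ⟨_, ht1⟩
      · exact ⟨_, hk.1⟩
    ext (h | ⟨i, j, r⟩)
    · exact hH h
    · obtain ⟨j0, h0⟩ := all i
      by_cases hj : j0 = j
      · subst hj; exact h0 r
      · exact leg_other hP hv hx i j0 j hj hℓ hH h0 r
end

lemma card_le_of_eig {ℓ : ℕ} (L : Matrix (Fin ℓ) (Fin ℓ) ℝ) (s : Finset ℝ)
    (hs : ∀ l ∈ s, Module.End.eigenspace (Matrix.toLin' L) l ≠ ⊥) : s.card ≤ ℓ := by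
  have h := sum_finrank_eigenspace_le (Matrix.toLin' L) s
  rw [Module.finrank_fin_fun] at h
  refine le_trans ?_ h
  rw [Finset.card_eq_sum_ones]
  apply Finset.sum_le_sum
  intro l hl
  exact Nat.one_le_iff_ne_zero.mpr (fun h0 => hs l hl (Submodule.finrank_eq_zero.mp h0))

lemma main_bound {m : ℕ} (H : SimpleGraph (Fin m)) (v : Fin 3 → Fin m)
    (hv : Function.Injective v)
    (huniq : ∀ s t u : Fin 3, s ≠ t → t ≠ u → s ≠ u →
      ∃! w : H.Walk (v s) (v t), w.IsPath ∧ v u ∉ w.support ∧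
        ∀ w' : H.Walk (v s) (v t), w'.IsPath → v u ∉ w'.support →
          w.length ≤ w'.length)
    (ℓ : ℕ) (hℓ : 1 ≤ ℓ)
    (A : Matrix (Fin m ⊕ Fin 3 × Fin 2 × Fin ℓ) (Fin m ⊕ Fin 3 × Fin 2 × Fin ℓ) ℝ)
    (hA : A.IsSymm) (hG : graphOf A = attachSixLegs H v ℓ) :
    9 * ℓ + 30 ≤ 4 * A.charpoly.roots.toFinset.card + 8 * m := by
  classical
  have hP := pat_of H v A hA hG
  set σ := A.charpoly.roots.toFinset with hσ
  have hcard := card_le_sum_finrank A hA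
  rw [← hσ] at hcard
  simp only [Fintype.card_sum, Fintype.card_fin, Fintype.card_prod] at hcard
  obtain ⟨Y, hY, hYs⟩ := exists_Y0 v hv (A.submatrix Sum.inl Sum.inl)
  have hM : ∀ x y, x ≠ y → ((A.submatrix Sum.inl Sum.inl) x y ≠ 0 ↔ H.Adj x y) := hP.hh
  obtain ⟨Y0, hY0, hY0s⟩ := exists_Yk H v hv _ hM 1 2 0 (by decide) (by decide) (by decide)
    (huniq _ _ _ (by decide) (by decide) (by decide))
  obtain ⟨Y1, hY1, hY1s⟩ := exists_Yk H v hv _ hM 0 2 1 (by decide) (by decide) (by decide)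
    (huniq _ _ _ (by decide) (by decide) (by decide))
  obtain ⟨Y2, hY2, hY2s⟩ := exists_Yk H v hv _ hM 0 1 2 (by decide) (by decide) (by decide)
    (huniq _ _ _ (by decide) (by decide) (by decide))
  let C : Fin 3 → Finset ℝ := fun i => σ.filter (fun l => ∀ j,
    Module.End.eigenspace (Matrix.toLin' (legM A i j)) l ≠ ⊥)
  have hC : ∀ i, (C i).card ≤ ℓ := fun i => card_le_of_eig (legM A i 0) (C i) (fun l hl =>
    (Finset.mem_filter.mp hl).2 0)
  have hCn : ∀ i, ∀ l ∈ σ, l ∉ C i →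
      ∃ j, Module.End.eigenspace (Matrix.toLin' (legM A i j)) l = ⊥ := by
    intro i l hl hn
    by_contra h
    push Not at h
    exact hn (Finset.mem_filter.mpr ⟨hl, h⟩)
  have hCs : ∀ i, ∑ l ∈ σ, (if l ∈ C i then 1 else 0) ≤ ℓ := by
    intro i
    rw [← Finset.card_filter]
    refine le_trans (Finset.card_le_card ?_) (hC i)
    intro l hl
    exact (Finset.mem_filter.mp hl).2
  have key : ∀ l ∈ σ, 2 * Module.finrank ℝ (Module.End.eigenspace (Matrix.toLin' A) l) ≤
      4 + 2 * Module.finrank ℝ (Y l) + 2 * Module.finrank ℝ (Y0 l) +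
        2 * Module.finrank ℝ (Y1 l) + 2 * Module.finrank ℝ (Y2 l) +
        ((if l ∈ C 0 then 1 else 0) + (if l ∈ C 1 then 1 else 0) + (if l ∈ C 2 then 1 else 0)) := by
    intro l hl
    have b := mult_le_three hP hv hℓ (Y l) (hY l)
    have b0 := mult_le_two hP hv hℓ 1 2 0 (by decide) (by decide) (by decide) (Y0 l) (hY0 l)
    have b1 := mult_le_two hP hv hℓ 0 2 1 (by decide) (by decide) (by decide) (Y1 l) (hY1 l)
    have b2 := mult_le_two hP hv hℓ 0 1 2 (by decide) (by decide) (by decide) (Y2 l) (hY2 l)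
    have c0 := hCn 0 l hl
    have c1 := hCn 1 l hl
    have c2 := hCn 2 l hl
    by_cases d0 : l ∈ C 0 <;> by_cases d1 : l ∈ C 1 <;> by_cases d2 : l ∈ C 2 <;>
      simp only [d0, d1, d2, if_true, if_false]
    · omega
    · omega
    · omega
    · have := b0 (c1 d1) (c2 d2); omega
    · omega
    · have := b1 (c0 d0) (c2 d2); omega
    · have := b2 (c0 d0) (c1 d1); omega
    · have := b0 (c1 d1) (c2 d2); omega
  have hsum := Finset.sum_le_sum key
  simp only [Finset.sum_add_distrib, ← Finset.mul_sum, Finset.sum_const, smul_eq_mul] at hsum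
  have e := hYs σ
  have e0 := hY0s σ
  have e1 := hY1s σ
  have e2 := hY2s σ
  have f0 := hCs 0
  have f1 := hCs 1
  have f2 := hCs 2
  omega

end helpers

/-- Let `H` be a connected graph on `m` vertices with distinct distinguished vertices
`v 0, v 1, v 2` such that for every choice `{s,t,u} = {0,1,2}` there is a unique shortest
path in `H` from `v s` to `v t` avoiding `v u`, and let `G` be the graph on `n = 6ℓ + m`
vertices obtained by attaching two legs with `ℓ` vertices (`ℓ ≥ 1`) at each `v i`.  Then
`q(G) ≥ 9ℓ/4 - 2m + 15/2`. -/
theorem minDistinctEigen_attachSixLegs {m : ℕ} (H : SimpleGraph (Fin m))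
    (hH : H.Connected) (v : Fin 3 → Fin m) (hv : Function.Injective v)
    (huniq : ∀ s t u : Fin 3, s ≠ t → t ≠ u → s ≠ u →
      ∃! w : H.Walk (v s) (v t), w.IsPath ∧ v u ∉ w.support ∧
        ∀ w' : H.Walk (v s) (v t), w'.IsPath → v u ∉ w'.support →
          w.length ≤ w'.length)
    (ℓ : ℕ) (hℓ : 1 ≤ ℓ) :
    9 * (ℓ : ℚ) / 4 - 2 * (m : ℚ) + 15 / 2 ≤
      (minDistinctEigen (attachSixLegs H v ℓ) : ℚ) := by
  classical
  have hne : {q | ∃ A : Matrix (Fin m ⊕ Fin 3 × Fin 2 × Fin ℓ) (Fin m ⊕ Fin 3 × Fin 2 × Fin ℓ) ℝ,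
      A.IsSymm ∧ graphOf A = attachSixLegs H v ℓ ∧
      q = A.charpoly.roots.toFinset.card}.Nonempty := by
    refine ⟨_, (attachSixLegs H v ℓ).adjMatrix ℝ, ?_, ?_, rfl⟩
    · exact (attachSixLegs H v ℓ).isSymm_adjMatrix
    · ext a b
      simp only [graphOf, SimpleGraph.fromRel_adj, SimpleGraph.adjMatrix_apply]
      constructor
      · rintro ⟨-, h | h⟩
        · by_contra hc; simp [hc] at h
        · by_contra hc; simp [SimpleGraph.adj_comm, hc] at h
      · intro h
        exact ⟨h.ne, Or.inl (by simp [h])⟩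
  obtain ⟨A, hA, hG, hq⟩ := Nat.sInf_mem hne
  have hb := main_bound H v hv huniq ℓ hℓ A hA hG
  have hq' : minDistinctEigen (attachSixLegs H v ℓ) = A.charpoly.roots.toFinset.card := hq
  rw [hq']
  have : (9 * ℓ + 30 : ℚ) ≤ 4 * (A.charpoly.roots.toFinset.card : ℚ) + 8 * m := by
    exact_mod_cast hb
  linarith
end

section
/- Let T be the tree on vertices 1,…,10 with edges {1,4}, {1,5}, {1,6}, {2,6}, {2,7}, {2,8}, {3,6}, {3,9}, {3,10}. If B is a real symmetric matrix with graph T whose distinct eigenvalues are λ_1 < λ_2 < λ_3 < λ_4 < λ_5 with algebraic multiplicities 1, 2, 4, 2, 1 respectively, then λ_1 + λ_5 = λ_2 + λ_4. In particular, the list (2, 3, 3, 5, 5, 5, 5, 7, 7, 10) is not the spectrum of any real symmetric matrix with graph T, even though the ordered multiplicity list ⟨1, 2, 4, 2, 1⟩ is attained by some matrix in S(T). -/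
open Polynomial Matrix

/-- The tree on vertices `1, …, 10` (encoded as `0, …, 9 : Fin 10`) with edges
`{1,4}, {1,5}, {1,6}, {2,6}, {2,7}, {2,8}, {3,6}, {3,9}, {3,10}`. -/
def exampleTree : SimpleGraph (Fin 10) :=
  SimpleGraph.fromRel (fun a b =>
    (a, b) ∈ [((0 : Fin 10), (3 : Fin 10)), (0, 4), (0, 5), (1, 5), (1, 6), (1, 7),
      (2, 5), (2, 8), (2, 9)])


lemma exists_vec (B : Matrix (Fin 10) (Fin 10) ℝ) (hB : B.IsSymm) (l : ℝ) (m : ℕ)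
    (h : m < B.charpoly.rootMultiplicity l) (s : Fin m → Fin 10) :
    ∃ v : Fin 10 → ℝ, v ≠ 0 ∧ B *ᵥ v = l • v ∧ ∀ i, v (s i) = 0 := by
  have hH : B.IsHermitian := by
    unfold Matrix.IsHermitian; rw [Matrix.conjTranspose_eq_transpose_of_trivial]; exact hB
  have hcard : Fintype.card {i // hH.eigenvalues i = l} = B.charpoly.rootMultiplicity l := by
    rw [← Polynomial.count_roots, hH.roots_charpoly_eq_eigenvalues, Multiset.count_map,
      Fintype.card_subtype]
    simp [Finset.card_def, eq_comm]
  let u : {i // hH.eigenvalues i = l} → Fin 10 → ℝ := fun i => (hH.eigenvectorBasis i.1).ofLp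
  have hu : LinearIndependent ℝ u := by
    have h1 := hH.eigenvectorBasis.orthonormal.linearIndependent
    have h2 := h1.comp (Subtype.val : {i // hH.eigenvalues i = l} → Fin 10)
      Subtype.val_injective
    exact h2.map' (WithLp.linearEquiv 2 ℝ (Fin 10 → ℝ)).toLinearMap (LinearEquiv.ker _)
  let φ : ({i // hH.eigenvalues i = l} → ℝ) →ₗ[ℝ] (Fin m → ℝ) :=
    (LinearMap.funLeft ℝ ℝ s).comp (Fintype.linearCombination ℝ u)
  have hk : LinearMap.ker φ ≠ ⊥ := LinearMap.ker_ne_bot_of_finrank_lt (by simp [hcard, h])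
  obtain ⟨c, hc, hc0⟩ := (Submodule.ne_bot_iff _).1 hk
  refine ⟨Fintype.linearCombination ℝ u c, ?_, ?_, ?_⟩
  · intro h0
    apply hc0
    rw [Fintype.linearCombination_apply] at h0
    funext i
    exact Fintype.linearIndependent_iff.1 hu c h0 i
  · rw [Fintype.linearCombination_apply, Matrix.mulVec_sum, Finset.smul_sum]
    refine Finset.sum_congr rfl fun i _ => ?_
    rw [Matrix.mulVec_smul, smul_comm l]
    congr 1
    have := hH.mulVec_eigenvectorBasis i.1
    rw [i.2] at this
    simpa [u] using this
  · intro i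
    exact congrFun (LinearMap.mem_ker.1 hc) i

lemma arm0 {a d p q b l v x y z : ℝ} (hp : p ≠ 0) (hq : q ≠ 0)
    (h1 : p * v + d * x = l * x) (h2 : a * v + p * x + q * y + b * z = l * v)
    (hx : x = 0) (hz : z = 0) : v = 0 ∧ y = 0 := by
  subst hx hz
  have hv : v = 0 := by simpa [hp] using h1
  subst hv
  exact ⟨rfl, by simpa [hq] using h2⟩

lemma arm1 {a d p q b l v x y z : ℝ} (hq : q ≠ 0) (hd : d ≠ l)
    (h1 : p * v + d * x = l * x) (h2 : a * v + p * x + q * y + b * z = l * v)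
    (hv : v = 0) (hz : z = 0) : x = 0 ∧ y = 0 := by
  subst hv hz
  have hx : x = 0 := by
    have : (d - l) * x = 0 := by linarith
    exact (mul_eq_zero.1 this).resolve_left (sub_ne_zero.2 hd)
  subst hx
  exact ⟨rfl, by simpa [hq] using h2⟩

/-- vanishing of an arm when the arm vertex vanishes and the leaves are not resonant -/
lemma arm2 {d e p q l v x y : ℝ} (hd : d ≠ l) (he : e ≠ l)
    (h1 : p * v + d * x = l * x) (h2 : q * v + e * y = l * y)
    (hv : v = 0) : x = 0 ∧ y = 0 := by
  subst hv
  constructor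
  · have : (d - l) * x = 0 := by linarith
    exact (mul_eq_zero.1 this).resolve_left (sub_ne_zero.2 hd)
  · have : (e - l) * y = 0 := by linarith
    exact (mul_eq_zero.1 this).resolve_left (sub_ne_zero.2 he)

lemma arm3 {a d p q b l v x y z : ℝ} (h1 : p * v + d * x = l * x) (h3 : q * v + d * y = l * y)
    (h2 : a * v + p * x + q * y + b * z = l * v) (hv : v ≠ 0) (hz : z = 0) :
    (l - a) * (l - d) = p ^ 2 + q ^ 2 := by
  subst hz
  have : ((l - a) * (l - d) - (p ^ 2 + q ^ 2)) * v = 0 := by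
    linear_combination (l - d) * (-h2) - p * h1 - q * h3
  have := (mul_eq_zero.1 this).resolve_right hv
  linarith

/-- The eigenvector equations for the tree. -/
structure Eqs (B : Matrix (Fin 10) (Fin 10) ℝ) (l : ℝ) (v : Fin 10 → ℝ) : Prop where
  e0 : B 0 0 * v 0 + B 0 3 * v 3 + B 0 4 * v 4 + B 0 5 * v 5 = l * v 0
  e1 : B 1 1 * v 1 + B 1 6 * v 6 + B 1 7 * v 7 + B 1 5 * v 5 = l * v 1
  e2 : B 2 2 * v 2 + B 2 8 * v 8 + B 2 9 * v 9 + B 2 5 * v 5 = l * v 2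
  e3 : B 0 3 * v 0 + B 3 3 * v 3 = l * v 3
  e4 : B 0 4 * v 0 + B 4 4 * v 4 = l * v 4
  e5 : B 0 5 * v 0 + B 1 5 * v 1 + B 2 5 * v 2 + B 5 5 * v 5 = l * v 5
  e6 : B 1 6 * v 1 + B 6 6 * v 6 = l * v 6
  e7 : B 1 7 * v 1 + B 7 7 * v 7 = l * v 7
  e8 : B 2 8 * v 2 + B 8 8 * v 8 = l * v 8
  e9 : B 2 9 * v 2 + B 9 9 * v 9 = l * v 9

lemma sum10 (f : Fin 10 → ℝ) : ∑ i, f i =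
    f 0 + f 1 + f 2 + f 3 + f 4 + f 5 + f 6 + f 7 + f 8 + f 9 := by
  simp [Fin.sum_univ_succ]
  ring

lemma adj_iff {B : Matrix (Fin 10) (Fin 10) ℝ} (hB : B.IsSymm)
    (hGB : graphOf B = exampleTree) (i j : Fin 10) (hij : i ≠ j) :
    B i j ≠ 0 ↔ exampleTree.Adj i j := by
  rw [← hGB]
  simp [graphOf, hij, hB.apply i j]

lemma eqs {B : Matrix (Fin 10) (Fin 10) ℝ} (hB : B.IsSymm)
    (hGB : graphOf B = exampleTree) {l : ℝ} {v : Fin 10 → ℝ} (h : B *ᵥ v = l • v) :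
    Eqs B l v := by
  have hz : ∀ i j : Fin 10, i ≠ j → ¬ exampleTree.Adj i j → B i j = 0 := by
    intro i j hij hn
    by_contra hne
    exact hn ((adj_iff hB hGB i j hij).1 hne)
  have key : ∀ i, ∑ j, B i j * v j = l * v i := fun i => congrFun h i
  have hs : ∀ i j, B i j = B j i := fun i j => hB.apply j i
  have hd : ∀ i j : Fin 10, i ≠ j → ¬ ((i, j) ∈ [((0 : Fin 10), (3 : Fin 10)), (0, 4), (0, 5),
      (1, 5), (1, 6), (1, 7), (2, 5), (2, 8), (2, 9)] ∨ (j, i) ∈ [((0 : Fin 10), (3 : Fin 10)),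
      (0, 4), (0, 5), (1, 5), (1, 6), (1, 7), (2, 5), (2, 8), (2, 9)]) → B i j = 0 := by
    intro i j hij hn
    refine hz i j hij fun hadj => hn ?_
    exact ((SimpleGraph.fromRel_adj _ _ _).1 hadj).2
  have k0 := key 0
  rw [sum10, hd 0 1 (by decide) (by decide), hd 0 2 (by decide) (by decide), hd 0 6 (by decide) (by decide), hd 0 7 (by decide) (by decide), hd 0 8 (by decide) (by decide), hd 0 9 (by decide) (by decide)] at k0
  have k1 := key 1
  rw [sum10, hd 1 0 (by decide) (by decide), hd 1 2 (by decide) (by decide), hd 1 3 (by decide) (by decide), hd 1 4 (by decide) (by decide), hd 1 8 (by decide) (by decide), hd 1 9 (by decide) (by decide)] at k1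
  have k2 := key 2
  rw [sum10, hd 2 0 (by decide) (by decide), hd 2 1 (by decide) (by decide), hd 2 3 (by decide) (by decide), hd 2 4 (by decide) (by decide), hd 2 6 (by decide) (by decide), hd 2 7 (by decide) (by decide)] at k2
  have k3 := key 3
  rw [sum10, hd 3 1 (by decide) (by decide), hd 3 2 (by decide) (by decide), hd 3 4 (by decide) (by decide), hd 3 5 (by decide) (by decide), hd 3 6 (by decide) (by decide), hd 3 7 (by decide) (by decide), hd 3 8 (by decide) (by decide), hd 3 9 (by decide) (by decide)] at k3
  have k4 := key 4
  rw [sum10, hd 4 1 (by decide) (by decide), hd 4 2 (by decide) (by decide), hd 4 3 (by decide) (by decide), hd 4 5 (by decide) (by decide), hd 4 6 (by decide) (by decide), hd 4 7 (by decide) (by decide), hd 4 8 (by decide) (by decide), hd 4 9 (by decide) (by decide)] at k4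
  have k5 := key 5
  rw [sum10, hd 5 3 (by decide) (by decide), hd 5 4 (by decide) (by decide), hd 5 6 (by decide) (by decide), hd 5 7 (by decide) (by decide), hd 5 8 (by decide) (by decide), hd 5 9 (by decide) (by decide)] at k5
  have k6 := key 6
  rw [sum10, hd 6 0 (by decide) (by decide), hd 6 2 (by decide) (by decide), hd 6 3 (by decide) (by decide), hd 6 4 (by decide) (by decide), hd 6 5 (by decide) (by decide), hd 6 7 (by decide) (by decide), hd 6 8 (by decide) (by decide), hd 6 9 (by decide) (by decide)] at k6
  have k7 := key 7
  rw [sum10, hd 7 0 (by decide) (by decide), hd 7 2 (by decide) (by decide), hd 7 3 (by decide) (by decide), hd 7 4 (by decide) (by decide), hd 7 5 (by decide) (by decide), hd 7 6 (by decide) (by decide), hd 7 8 (by decide) (by decide), hd 7 9 (by decide) (by decide)] at k7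
  have k8 := key 8
  rw [sum10, hd 8 0 (by decide) (by decide), hd 8 1 (by decide) (by decide), hd 8 3 (by decide) (by decide), hd 8 4 (by decide) (by decide), hd 8 5 (by decide) (by decide), hd 8 6 (by decide) (by decide), hd 8 7 (by decide) (by decide), hd 8 9 (by decide) (by decide)] at k8
  have k9 := key 9
  rw [sum10, hd 9 0 (by decide) (by decide), hd 9 1 (by decide) (by decide), hd 9 3 (by decide) (by decide), hd 9 4 (by decide) (by decide), hd 9 5 (by decide) (by decide), hd 9 6 (by decide) (by decide), hd 9 7 (by decide) (by decide), hd 9 8 (by decide) (by decide)] at k9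
  rw [hs 3 0] at k3
  rw [hs 4 0] at k4
  rw [hs 5 0, hs 5 1, hs 5 2] at k5
  rw [hs 6 1] at k6
  rw [hs 7 1] at k7
  rw [hs 8 2] at k8
  rw [hs 9 2] at k9
  constructor <;> linarith

lemma zero10 (v : Fin 10 → ℝ) (h0 : v 0 = 0) (h1 : v 1 = 0) (h2 : v 2 = 0) (h3 : v 3 = 0)
    (h4 : v 4 = 0) (h5 : v 5 = 0) (h6 : v 6 = 0) (h7 : v 7 = 0) (h8 : v 8 = 0) (h9 : v 9 = 0) :
    v = 0 := by
  funext i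
  fin_cases i <;> assumption

lemma main {B : Matrix (Fin 10) (Fin 10) ℝ} (hB : B.IsSymm)
    (hGB : graphOf B = exampleTree) (l1 l2 l3 l4 l5 : ℝ)
    (h12 : l1 < l2) (h23 : l2 < l3) (h34 : l3 < l4) (h45 : l4 < l5)
    (hr : B.charpoly.roots = {l1, l2, l2, l3, l3, l3, l3, l4, l4, l5}) :
    l1 + l5 = l2 + l4 := by
  have hH : B.IsHermitian := by
    unfold Matrix.IsHermitian; rw [Matrix.conjTranspose_eq_transpose_of_trivial]; exact hB
  have htr := Matrix.trace_eq_sum_roots_charpoly_of_splits hH.splits_charpoly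
  rw [hr] at htr
  simp only [Matrix.trace, sum10, Matrix.diag_apply, Multiset.insert_eq_cons, Multiset.sum_cons,
    Multiset.sum_singleton] at htr
  have m2 : 1 < B.charpoly.rootMultiplicity l2 := by
    rw [← Polynomial.count_roots, hr]
    simp [Multiset.count_cons, Multiset.count_singleton, h23.ne, h12.ne', (h23.trans h34).ne,
      (h23.trans (h34.trans h45)).ne]
  have m4 : 1 < B.charpoly.rootMultiplicity l4 := by
    rw [← Polynomial.count_roots, hr]
    simp [Multiset.count_cons, Multiset.count_singleton, h34.ne', h45.ne, (h23.trans h34).ne',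
      (h12.trans (h23.trans h34)).ne']
  have m3 : 3 < B.charpoly.rootMultiplicity l3 := by
    rw [← Polynomial.count_roots, hr]
    simp [Multiset.count_cons, Multiset.count_singleton, h23.ne', h34.ne, (h12.trans h23).ne',
      (h34.trans h45).ne]
  have nz : ∀ i j : Fin 10, i ≠ j → ((i, j) ∈ [((0 : Fin 10), (3 : Fin 10)), (0, 4), (0, 5),
      (1, 5), (1, 6), (1, 7), (2, 5), (2, 8), (2, 9)]) → B i j ≠ 0 := by
    intro i j hij hn
    exact (adj_iff hB hGB i j hij).2 ((SimpleGraph.fromRel_adj _ _ _).2 ⟨hij, Or.inl hn⟩)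
  have n03 : B 0 3 ≠ 0 := nz 0 3 (by decide) (by decide)
  have n04 : B 0 4 ≠ 0 := nz 0 4 (by decide) (by decide)
  have n05 : B 0 5 ≠ 0 := nz 0 5 (by decide) (by decide)
  have n15 : B 1 5 ≠ 0 := nz 1 5 (by decide) (by decide)
  have n16 : B 1 6 ≠ 0 := nz 1 6 (by decide) (by decide)
  have n17 : B 1 7 ≠ 0 := nz 1 7 (by decide) (by decide)
  have n25 : B 2 5 ≠ 0 := nz 2 5 (by decide) (by decide)
  have n28 : B 2 8 ≠ 0 := nz 2 8 (by decide) (by decide)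
  have n29 : B 2 9 ≠ 0 := nz 2 9 (by decide) (by decide)
  have d3 : B 3 3 = l3 := by
    by_contra hne
    obtain ⟨v, hv0, hv, hs⟩ := exists_vec B hB l3 3 m3 ![5, 6, 8]
    have E := eqs hB hGB hv
    have v5 : v 5 = 0 := hs 0
    have v6 : v 6 = 0 := hs 1
    have v8 : v 8 = 0 := hs 2
    obtain ⟨v1, v7⟩ := arm0 n16 n17 E.e6 E.e1 v6 v5
    obtain ⟨v2, v9⟩ := arm0 n28 n29 E.e8 E.e2 v8 v5
    have v0 : v 0 = 0 := by
      have := E.e5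
      simpa [v5, v1, v2, n05] using this
    have ea : B 0 0 * v 0 + B 0 3 * v 3 + B 0 4 * v 4 + B 0 5 * v 5 = l3 * v 0 := by
      linarith [E.e0]
    obtain ⟨v3, v4⟩ := arm1 n04 hne E.e3 ea v0 v5
    exact hv0 (zero10 v v0 v1 v2 v3 v4 v5 v6 v7 v8 v9)
  have d4 : B 4 4 = l3 := by
    by_contra hne
    obtain ⟨v, hv0, hv, hs⟩ := exists_vec B hB l3 3 m3 ![5, 6, 8]
    have E := eqs hB hGB hv
    have v5 : v 5 = 0 := hs 0
    have v6 : v 6 = 0 := hs 1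
    have v8 : v 8 = 0 := hs 2
    obtain ⟨v1, v7⟩ := arm0 n16 n17 E.e6 E.e1 v6 v5
    obtain ⟨v2, v9⟩ := arm0 n28 n29 E.e8 E.e2 v8 v5
    have v0 : v 0 = 0 := by
      have := E.e5
      simpa [v5, v1, v2, n05] using this
    have ea : B 0 0 * v 0 + B 0 4 * v 4 + B 0 3 * v 3 + B 0 5 * v 5 = l3 * v 0 := by
      linarith [E.e0]
    obtain ⟨v4, v3⟩ := arm1 n03 hne E.e4 ea v0 v5
    exact hv0 (zero10 v v0 v1 v2 v3 v4 v5 v6 v7 v8 v9)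
  have d6 : B 6 6 = l3 := by
    by_contra hne
    obtain ⟨v, hv0, hv, hs⟩ := exists_vec B hB l3 3 m3 ![5, 3, 8]
    have E := eqs hB hGB hv
    have v5 : v 5 = 0 := hs 0
    have v3 : v 3 = 0 := hs 1
    have v8 : v 8 = 0 := hs 2
    obtain ⟨v0, v4⟩ := arm0 n03 n04 E.e3 E.e0 v3 v5
    obtain ⟨v2, v9⟩ := arm0 n28 n29 E.e8 E.e2 v8 v5
    have v1 : v 1 = 0 := by
      have := E.e5
      simpa [v5, v0, v2, n15] using this
    have ea : B 1 1 * v 1 + B 1 6 * v 6 + B 1 7 * v 7 + B 1 5 * v 5 = l3 * v 1 := by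
      linarith [E.e1]
    obtain ⟨v6, v7⟩ := arm1 n17 hne E.e6 ea v1 v5
    exact hv0 (zero10 v v0 v1 v2 v3 v4 v5 v6 v7 v8 v9)
  have d7 : B 7 7 = l3 := by
    by_contra hne
    obtain ⟨v, hv0, hv, hs⟩ := exists_vec B hB l3 3 m3 ![5, 3, 8]
    have E := eqs hB hGB hv
    have v5 : v 5 = 0 := hs 0
    have v3 : v 3 = 0 := hs 1
    have v8 : v 8 = 0 := hs 2
    obtain ⟨v0, v4⟩ := arm0 n03 n04 E.e3 E.e0 v3 v5
    obtain ⟨v2, v9⟩ := arm0 n28 n29 E.e8 E.e2 v8 v5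
    have v1 : v 1 = 0 := by
      have := E.e5
      simpa [v5, v0, v2, n15] using this
    have ea : B 1 1 * v 1 + B 1 7 * v 7 + B 1 6 * v 6 + B 1 5 * v 5 = l3 * v 1 := by
      linarith [E.e1]
    obtain ⟨v7, v6⟩ := arm1 n16 hne E.e7 ea v1 v5
    exact hv0 (zero10 v v0 v1 v2 v3 v4 v5 v6 v7 v8 v9)
  have d8 : B 8 8 = l3 := by
    by_contra hne
    obtain ⟨v, hv0, hv, hs⟩ := exists_vec B hB l3 3 m3 ![5, 3, 6]
    have E := eqs hB hGB hv
    have v5 : v 5 = 0 := hs 0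
    have v3 : v 3 = 0 := hs 1
    have v6 : v 6 = 0 := hs 2
    obtain ⟨v0, v4⟩ := arm0 n03 n04 E.e3 E.e0 v3 v5
    obtain ⟨v1, v7⟩ := arm0 n16 n17 E.e6 E.e1 v6 v5
    have v2 : v 2 = 0 := by
      have := E.e5
      simpa [v5, v0, v1, n25] using this
    have ea : B 2 2 * v 2 + B 2 8 * v 8 + B 2 9 * v 9 + B 2 5 * v 5 = l3 * v 2 := by
      linarith [E.e2]
    obtain ⟨v8, v9⟩ := arm1 n29 hne E.e8 ea v2 v5
    exact hv0 (zero10 v v0 v1 v2 v3 v4 v5 v6 v7 v8 v9)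
  have d9 : B 9 9 = l3 := by
    by_contra hne
    obtain ⟨v, hv0, hv, hs⟩ := exists_vec B hB l3 3 m3 ![5, 3, 6]
    have E := eqs hB hGB hv
    have v5 : v 5 = 0 := hs 0
    have v3 : v 3 = 0 := hs 1
    have v6 : v 6 = 0 := hs 2
    obtain ⟨v0, v4⟩ := arm0 n03 n04 E.e3 E.e0 v3 v5
    obtain ⟨v1, v7⟩ := arm0 n16 n17 E.e6 E.e1 v6 v5
    have v2 : v 2 = 0 := by
      have := E.e5
      simpa [v5, v0, v1, n25] using this
    have ea : B 2 2 * v 2 + B 2 9 * v 9 + B 2 8 * v 8 + B 2 5 * v 5 = l3 * v 2 := by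
      linarith [E.e2]
    obtain ⟨v9, v8⟩ := arm1 n28 hne E.e9 ea v2 v5
    exact hv0 (zero10 v v0 v1 v2 v3 v4 v5 v6 v7 v8 v9)
  have d5 : B 5 5 = l3 := by
    by_contra hne
    obtain ⟨v, hv0, hv, hs⟩ := exists_vec B hB l3 3 m3 ![3, 6, 8]
    have E := eqs hB hGB hv
    have v3 : v 3 = 0 := hs 0
    have v6 : v 6 = 0 := hs 1
    have v8 : v 8 = 0 := hs 2
    have v0 : v 0 = 0 := by simpa [v3, n03] using E.e3
    have v1 : v 1 = 0 := by simpa [v6, n16] using E.e6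
    have v2 : v 2 = 0 := by simpa [v8, n28] using E.e8
    have v5 : v 5 = 0 := by
      have := E.e5
      simpa [v0, v1, v2, hne] using this
    have v4 := (arm0 n03 n04 E.e3 E.e0 v3 v5).2
    have v7 := (arm0 n16 n17 E.e6 E.e1 v6 v5).2
    have v9 := (arm0 n28 n29 E.e8 E.e2 v8 v5).2
    exact hv0 (zero10 v v0 v1 v2 v3 v4 v5 v6 v7 v8 v9)
  have R : ∀ l : ℝ, l3 ≠ l → 1 < B.charpoly.rootMultiplicity l →
      ((l - B 0 0) * (l - l3) = B 0 3 ^ 2 + B 0 4 ^ 2 ∧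
        (l - B 1 1) * (l - l3) = B 1 6 ^ 2 + B 1 7 ^ 2 ∧
        (l - B 2 2) * (l - l3) = B 2 8 ^ 2 + B 2 9 ^ 2) := by
    intro l hl hm
    have S0 : (l - B 1 1) * (l - l3) = B 1 6 ^ 2 + B 1 7 ^ 2 ∧
        (l - B 2 2) * (l - l3) = B 2 8 ^ 2 + B 2 9 ^ 2 := by
      obtain ⟨v, hv0, hv, hs⟩ := exists_vec B hB l 1 hm ![0]
      have E := eqs hB hGB hv
      have v0 : v 0 = 0 := hs 0
      obtain ⟨E0, E1, E2, E3, E4, E5, E6, E7, E8, E9⟩ := E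
      rw [d3] at E3
      rw [d4] at E4
      rw [d6] at E6
      rw [d7] at E7
      rw [d8] at E8
      rw [d9] at E9
      obtain ⟨v3, v4⟩ := arm2 hl hl E3 E4 v0
      have v5 : v 5 = 0 := by simpa [v0, v3, v4, n05] using E0
      have hc : B 1 5 * v 1 + B 2 5 * v 2 = 0 := by simpa [v0, v5] using E5
      have w1 : v 1 ≠ 0 := by
        intro v1
        have v2 : v 2 = 0 := by simpa [v1, n25] using hc
        obtain ⟨v6, v7⟩ := arm2 hl hl E6 E7 v1
        obtain ⟨v8, v9⟩ := arm2 hl hl E8 E9 v2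
        exact hv0 (zero10 v v0 v1 v2 v3 v4 v5 v6 v7 v8 v9)
      have w2 : v 2 ≠ 0 := by
        intro v2
        have v1 : v 1 = 0 := by simpa [v2, n15] using hc
        obtain ⟨v8, v9⟩ := arm2 hl hl E8 E9 v2
        obtain ⟨v6, v7⟩ := arm2 hl hl E6 E7 v1
        exact hv0 (zero10 v v0 v1 v2 v3 v4 v5 v6 v7 v8 v9)
      exact ⟨arm3 E6 E7 E1 w1 v5, arm3 E8 E9 E2 w2 v5⟩
    have S1 : (l - B 0 0) * (l - l3) = B 0 3 ^ 2 + B 0 4 ^ 2 ∧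
        (l - B 2 2) * (l - l3) = B 2 8 ^ 2 + B 2 9 ^ 2 := by
      obtain ⟨v, hv0, hv, hs⟩ := exists_vec B hB l 1 hm ![1]
      have E := eqs hB hGB hv
      have v1 : v 1 = 0 := hs 0
      obtain ⟨E0, E1, E2, E3, E4, E5, E6, E7, E8, E9⟩ := E
      rw [d3] at E3
      rw [d4] at E4
      rw [d6] at E6
      rw [d7] at E7
      rw [d8] at E8
      rw [d9] at E9
      obtain ⟨v6, v7⟩ := arm2 hl hl E6 E7 v1
      have v5 : v 5 = 0 := by simpa [v1, v6, v7, n15] using E1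
      have hc : B 0 5 * v 0 + B 2 5 * v 2 = 0 := by simpa [v1, v5] using E5
      have w0 : v 0 ≠ 0 := by
        intro v0
        have v2 : v 2 = 0 := by simpa [v0, n25] using hc
        obtain ⟨v3, v4⟩ := arm2 hl hl E3 E4 v0
        obtain ⟨v8, v9⟩ := arm2 hl hl E8 E9 v2
        exact hv0 (zero10 v v0 v1 v2 v3 v4 v5 v6 v7 v8 v9)
      have w2 : v 2 ≠ 0 := by
        intro v2
        have v0 : v 0 = 0 := by simpa [v2, n05] using hc
        obtain ⟨v8, v9⟩ := arm2 hl hl E8 E9 v2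
        obtain ⟨v3, v4⟩ := arm2 hl hl E3 E4 v0
        exact hv0 (zero10 v v0 v1 v2 v3 v4 v5 v6 v7 v8 v9)
      exact ⟨arm3 E3 E4 E0 w0 v5, arm3 E8 E9 E2 w2 v5⟩
    have S2 : (l - B 0 0) * (l - l3) = B 0 3 ^ 2 + B 0 4 ^ 2 ∧
        (l - B 1 1) * (l - l3) = B 1 6 ^ 2 + B 1 7 ^ 2 := by
      obtain ⟨v, hv0, hv, hs⟩ := exists_vec B hB l 1 hm ![2]
      have E := eqs hB hGB hv
      have v2 : v 2 = 0 := hs 0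
      obtain ⟨E0, E1, E2, E3, E4, E5, E6, E7, E8, E9⟩ := E
      rw [d3] at E3
      rw [d4] at E4
      rw [d6] at E6
      rw [d7] at E7
      rw [d8] at E8
      rw [d9] at E9
      obtain ⟨v8, v9⟩ := arm2 hl hl E8 E9 v2
      have v5 : v 5 = 0 := by simpa [v2, v8, v9, n25] using E2
      have hc : B 0 5 * v 0 + B 1 5 * v 1 = 0 := by simpa [v2, v5] using E5
      have w0 : v 0 ≠ 0 := by
        intro v0
        have v1 : v 1 = 0 := by simpa [v0, n15] using hc
        obtain ⟨v3, v4⟩ := arm2 hl hl E3 E4 v0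
        obtain ⟨v6, v7⟩ := arm2 hl hl E6 E7 v1
        exact hv0 (zero10 v v0 v1 v2 v3 v4 v5 v6 v7 v8 v9)
      have w1 : v 1 ≠ 0 := by
        intro v1
        have v0 : v 0 = 0 := by simpa [v1, n05] using hc
        obtain ⟨v6, v7⟩ := arm2 hl hl E6 E7 v1
        obtain ⟨v3, v4⟩ := arm2 hl hl E3 E4 v0
        exact hv0 (zero10 v v0 v1 v2 v3 v4 v5 v6 v7 v8 v9)
      exact ⟨arm3 E3 E4 E0 w0 v5, arm3 E6 E7 E1 w1 v5⟩
    exact ⟨S1.1, S0.1, S0.2⟩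
  obtain ⟨p0, p1, p2⟩ := R l2 h23.ne' m2
  obtain ⟨q0, q1, q2⟩ := R l4 h34.ne m4
  have hne : l4 - l2 ≠ 0 := (sub_pos.2 (h23.trans h34)).ne'
  have fin : ∀ a r : ℝ, (l2 - a) * (l2 - l3) = r → (l4 - a) * (l4 - l3) = r →
      a = l2 + l4 - l3 := by
    intro a r h h'
    have : (l4 - l2) * (l2 + l4 - l3 - a) = 0 := by linear_combination h' - h
    have := (mul_eq_zero.1 this).resolve_left hne
    linarith
  have a0 := fin _ _ p0 q0
  have a1 := fin _ _ p1 q1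
  have a2 := fin _ _ p2 q2
  rw [a0, a1, a2, d3, d4, d5, d6, d7, d8, d9] at htr
  linarith


def exB : Matrix (Fin 10) (Fin 10) ℚ := Matrix.of
  ![![0, 0, 0, 3, 4, 1, 0, 0, 0, 0],
    ![0, 0, 0, 0, 0, 1, 3, 4, 0, 0],
    ![0, 0, 0, 0, 0, 3, 0, 0, 3, 4],
    ![3, 0, 0, 0, 0, 0, 0, 0, 0, 0],
    ![4, 0, 0, 0, 0, 0, 0, 0, 0, 0],
    ![1, 1, 3, 0, 0, 0, 0, 0, 0, 0],
    ![0, 3, 0, 0, 0, 0, 0, 0, 0, 0],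
    ![0, 4, 0, 0, 0, 0, 0, 0, 0, 0],
    ![0, 0, 3, 0, 0, 0, 0, 0, 0, 0],
    ![0, 0, 4, 0, 0, 0, 0, 0, 0, 0]]

/-- Rows are (orthogonal) eigenvectors of `exB`. -/
def exU : Matrix (Fin 10) (Fin 10) ℚ := Matrix.of
  ![![-6, -6, -18, 3, 4, 11, 3, 4, 9, 12],
    ![-5, 5, 0, 3, 4, 0, -3, -4, 0, 0],
    ![-15, -15, 10, 9, 12, 0, 9, 12, -6, -8],
    ![0, 0, 0, 4, -3, 0, 0, 0, 0, 0],
    ![0, 0, 0, 0, 0, 0, 4, -3, 0, 0],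
    ![0, 0, 0, 0, 0, 0, 0, 0, 4, -3],
    ![0, 0, 0, -3, -4, 25, -3, -4, -9, -12],
    ![5, -5, 0, 3, 4, 0, -3, -4, 0, 0],
    ![15, 15, -10, 9, 12, 0, 9, 12, -6, -8],
    ![6, 6, 18, 3, 4, 11, 3, 4, 9, 12]]

def exD : Fin 10 → ℚ := ![-6, -5, -5, 0, 0, 0, 0, 5, 5, 6]

def exN : Fin 10 → ℚ := ![1/792, 1/100, 1/1100, 1/25, 1/25, 1/25, 1/900, 1/100, 1/1100, 1/792]


lemma exVU : (Matrix.diagonal exN * exU) * exUᵀ = 1 := by decide +kernel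

lemma exBU : exB = exUᵀ * (Matrix.diagonal exD * (Matrix.diagonal exN * exU)) := by
  decide +kernel

lemma exchar : exB.charpoly = ∏ i, (X - C (exD i)) := by
  rw [exBU, Matrix.charpoly_mul_comm, Matrix.mul_assoc, exVU, Matrix.mul_one,
    Matrix.charpoly_diagonal]

noncomputable def exR : Matrix (Fin 10) (Fin 10) ℝ := exB.map (algebraMap ℚ ℝ)

lemma exRroots : exR.charpoly.roots =
    ({-6, -5, -5, 0, 0, 0, 0, 5, 5, 6} : Multiset ℝ) := by
  have h : exR.charpoly =
      (Multiset.map (fun a => X - C a) ({-6, -5, -5, 0, 0, 0, 0, 5, 5, 6} : Multiset ℝ)).prod := by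
    rw [exR, Matrix.charpoly_map, exchar, Polynomial.map_prod]
    simp [Fin.prod_univ_succ, exD]
  rw [h, Polynomial.roots_multiset_prod_X_sub_C]

lemma exRsymm : exR.IsSymm := by
  have : exB.IsSymm := by unfold Matrix.IsSymm; decide +kernel
  exact this.map _

lemma exRgraph : graphOf exR = exampleTree := by
  have h : ∀ i j : Fin 10, (exB i j ≠ 0 ∨ exB j i ≠ 0) ↔
      ((i, j) ∈ [((0 : Fin 10), (3 : Fin 10)), (0, 4), (0, 5),
      (1, 5), (1, 6), (1, 7), (2, 5), (2, 8), (2, 9)] ∨ (j, i) ∈ [((0 : Fin 10), (3 : Fin 10)),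
      (0, 4), (0, 5), (1, 5), (1, 6), (1, 7), (2, 5), (2, 8), (2, 9)]) := by
    have e : ∀ i j : Fin 10, decide (exB i j ≠ 0 ∨ exB j i ≠ 0) =
      decide ((i, j) ∈ [((0 : Fin 10), (3 : Fin 10)), (0, 4), (0, 5),
      (1, 5), (1, 6), (1, 7), (2, 5), (2, 8), (2, 9)] ∨ (j, i) ∈ [((0 : Fin 10), (3 : Fin 10)),
      (0, 4), (0, 5), (1, 5), (1, 6), (1, 7), (2, 5), (2, 8), (2, 9)]) := by decide +kernel
    intro i j
    exact decide_eq_decide.1 (e i j)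
  have h' : ∀ i j, exR i j ≠ 0 ↔ exB i j ≠ 0 := by
    intro i j
    simp [exR]
  ext i j
  rw [graphOf, exampleTree, SimpleGraph.fromRel_adj, SimpleGraph.fromRel_adj, h', h', h]

/-- If `B` is a real symmetric matrix whose graph is the tree `exampleTree` and whose
distinct eigenvalues are `λ₁ < λ₂ < λ₃ < λ₄ < λ₅` with multiplicities `1, 2, 4, 2, 1`,
then `λ₁ + λ₅ = λ₂ + λ₄`.  In particular `(2,3,3,5,5,5,5,7,7,10)` is not the spectrum of
any real symmetric matrix with this graph, although the ordered multiplicity list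
`⟨1,2,4,2,1⟩` is attained by some such matrix. -/
theorem exampleTree_spectrum_constraint
    (B : Matrix (Fin 10) (Fin 10) ℝ) (hB : B.IsSymm) (hGB : graphOf B = exampleTree)
    (l1 l2 l3 l4 l5 : ℝ)
    (h12 : l1 < l2) (h23 : l2 < l3) (h34 : l3 < l4) (h45 : l4 < l5)
    (hroots : B.charpoly.roots.toFinset = {l1, l2, l3, l4, l5})
    (hm1 : B.charpoly.rootMultiplicity l1 = 1)
    (hm2 : B.charpoly.rootMultiplicity l2 = 2)
    (hm3 : B.charpoly.rootMultiplicity l3 = 4)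
    (hm4 : B.charpoly.rootMultiplicity l4 = 2)
    (hm5 : B.charpoly.rootMultiplicity l5 = 1) :
    l1 + l5 = l2 + l4 ∧
    (¬ ∃ B' : Matrix (Fin 10) (Fin 10) ℝ, B'.IsSymm ∧ graphOf B' = exampleTree ∧
      B'.charpoly.roots = ({2, 3, 3, 5, 5, 5, 5, 7, 7, 10} : Multiset ℝ)) ∧
    (∃ (B' : Matrix (Fin 10) (Fin 10) ℝ) (m1 m2 m3 m4 m5 : ℝ),
      B'.IsSymm ∧ graphOf B' = exampleTree ∧
      m1 < m2 ∧ m2 < m3 ∧ m3 < m4 ∧ m4 < m5 ∧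
      B'.charpoly.roots.toFinset = {m1, m2, m3, m4, m5} ∧
      B'.charpoly.rootMultiplicity m1 = 1 ∧
      B'.charpoly.rootMultiplicity m2 = 2 ∧
      B'.charpoly.rootMultiplicity m3 = 4 ∧
      B'.charpoly.rootMultiplicity m4 = 2 ∧
      B'.charpoly.rootMultiplicity m5 = 1) := by
  refine ⟨?_, ?_, ?_⟩
  · refine main hB hGB l1 l2 l3 l4 l5 h12 h23 h34 h45 ?_
    have h13 := h12.trans h23
    have h14 := h13.trans h34
    have h15 := h14.trans h45
    have h24 := h23.trans h34
    have h25 := h24.trans h45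
    have h35 := h34.trans h45
    ext x
    by_cases hx : x ∈ B.charpoly.roots
    · have hx' := Multiset.mem_toFinset.2 hx
      rw [hroots] at hx'
      simp only [Finset.mem_insert, Finset.mem_singleton] at hx'
      rw [Polynomial.count_roots]
      rcases hx' with rfl | rfl | rfl | rfl | rfl <;>
      simp [*, Multiset.count_cons, Multiset.count_singleton, h12.ne, h13.ne, h14.ne, h15.ne,
        h23.ne, h24.ne, h25.ne, h34.ne, h35.ne, h45.ne, h12.ne', h13.ne', h14.ne', h15.ne',
        h23.ne', h24.ne', h25.ne', h34.ne', h35.ne', h45.ne']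
    · rw [Multiset.count_eq_zero_of_notMem hx, eq_comm, Multiset.count_eq_zero]
      intro hx'
      apply hx
      rw [← Multiset.mem_toFinset, hroots]
      simp only [Multiset.insert_eq_cons, Multiset.mem_cons, Multiset.mem_singleton] at hx'
      rcases hx' with h | h | h | h | h | h | h | h | h | h <;> simp [h]
  · rintro ⟨B', hs, hg, hr⟩
    have := main hs hg 2 3 5 7 10 (by norm_num) (by norm_num) (by norm_num) (by norm_num) hr
    norm_num at this
  · refine ⟨exR, -6, -5, 0, 5, 6, exRsymm, exRgraph, by norm_num, by norm_num, by norm_num,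
      by norm_num, ?_, ?_, ?_, ?_, ?_, ?_⟩
    · rw [exRroots]
      ext x
      simp
    all_goals
      rw [← Polynomial.count_roots, exRroots]
      norm_num [Multiset.count_cons, Multiset.count_singleton]
end
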